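/- Let f : ℝ⁴ → ℂ be a Schwartz function of unit frequency, and let u(t,x) = e^{it√(−Δ)}f(x). Then for all exponents q ∈ [2,∞), r ∈ [2,∞) satisfying 1/q + 3/(2r) ≥ 3/4 and 1/q + 3/r < 3/2 (i.e. exponent pairs forbidden for the classical Strichartz estimates but admissible for angularly regular data) there is a constant C_{q,r} (independent of f) such that ‖u‖_{L^q_t L^r_x} ≤ C_{q,r} ( ‖f‖_{L²(ℝ⁴)} + Σ_{1≤i<j≤4} ‖Ω_{ij} f‖_{L²(ℝ⁴)} ). -/

import Mathlib

open MeasureTheory Complex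
open scoped FourierTransform RealInnerProductSpace ENNReal BigOperators

noncomputable section

/-- Four-dimensional Euclidean space. -/
abbrev Sp : Type := EuclideanSpace ℝ (Fin 4)

/-- The half-wave propagator `e^{it√(−Δ)}f(x) = ∫ e^{2πi(t|ξ| + x·ξ)} f̂(ξ) dξ`. -/
def halfWave (f : Sp → ℂ) (t : ℝ) (x : Sp) : ℂ :=
  ∫ ξ : Sp, Complex.exp (2 * Real.pi * Complex.I * ((t * ‖ξ‖ + ⟪x, ξ⟫ : ℝ) : ℂ)) * 𝓕 f ξ

/-- `f` has unit frequency: `f̂` is supported in the annulus `{1/2 ≤ |ξ| ≤ 2}`. -/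
def UnitFrequency (f : Sp → ℂ) : Prop :=
  ∀ ξ : Sp, 𝓕 f ξ ≠ 0 → 1/2 ≤ ‖ξ‖ ∧ ‖ξ‖ ≤ 2

/-- The mixed space-time norm `‖u‖_{L^q_t L^r_x}`. -/
def LqLr (q r : ℝ≥0∞) (u : ℝ → Sp → ℂ) : ℝ≥0∞ :=
  eLpNorm (fun t => (eLpNorm (u t) r volume).toReal) q volume

/-- The angular momentum (rotation) vector fields `Ω_{ij}f(x) = x_i ∂_j f − x_j ∂_i f`. -/
def Omega (i j : Fin 4) (f : Sp → ℂ) (x : Sp) : ℂ :=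
  (x i : ℂ) * fderiv ℝ f x (EuclideanSpace.single j (1:ℝ))
    - (x j : ℂ) * fderiv ℝ f x (EuclideanSpace.single i (1:ℝ))

/-- Schur's test for `T T*`: an `L²` bound for an oscillatory integral operator. -/
lemma lintegral_enorm_sq_le_of_schur {X Y : Type*} [MeasurableSpace X] [MeasurableSpace Y]
    {μ : Measure X} {ν : Measure Y} [SigmaFinite μ] [SigmaFinite ν] {φ : X → Y → ℂ}
    (hφ : Measurable (Function.uncurry φ)) {b : X → ℝ} (hb : Integrable (fun x => b x ^ 2) μ)
    (hφb : ∀ x y, ‖φ x y‖ ≤ b x) {H : Y → ℂ} (hH : Integrable H ν) {S : Set Y}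
    (hS : MeasurableSet S) (hHS : ∀ y, y ∉ S → H y = 0) {B : ℝ≥0∞}
    (hK : ∀ y ∈ S, ∫⁻ y' in S, ‖∫ x, φ x y * starRingEnd ℂ (φ x y') ∂μ‖ₑ ∂ν ≤ B) :
    ∫⁻ x, ‖∫ y, φ x y * H y ∂ν‖ₑ ^ 2 ∂μ ≤ 2 * B * ∫⁻ y, ‖H y‖ₑ ^ 2 ∂ν := by
  classical
  set v : X → ℂ := fun x => ∫ y, φ x y * H y ∂ν with hv
  set K : Y × Y → ℂ := fun p => ∫ x, φ x p.1 * starRingEnd ℂ (φ x p.2) ∂μ with hKdef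
  have hφ1 : Measurable fun q : X × Y × Y => φ q.1 q.2.1 :=
    hφ.comp (measurable_fst.prodMk (measurable_fst.comp measurable_snd))
  have hφ2 : Measurable fun q : X × Y × Y => φ q.1 q.2.2 :=
    hφ.comp (measurable_fst.prodMk (measurable_snd.comp measurable_snd))
  have hφφ : Measurable fun q : X × Y × Y => φ q.1 q.2.1 * starRingEnd ℂ (φ q.1 q.2.2) :=
    hφ1.mul (Complex.continuous_conj.measurable.comp hφ2)
  have hKm : Measurable K := by
    have : StronglyMeasurable
        (Function.uncurry fun (p : Y × Y) (x : X) => φ x p.1 * starRingEnd ℂ (φ x p.2)) :=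
      (hφφ.comp measurable_swap).stronglyMeasurable
    exact this.integral_prod_right.measurable
  have hHH : Integrable (fun p : Y × Y => H p.1 * starRingEnd ℂ (H p.2)) (ν.prod ν) := by
    refine hH.mul_prod (g := fun y => starRingEnd ℂ (H y)) ?_
    exact (integrable_norm_iff (Complex.continuous_conj.comp_aestronglyMeasurable hH.1)).1
      (by simpa using hH.norm)
  have h_int : Integrable (fun q : X × Y × Y => (φ q.1 q.2.1 * starRingEnd ℂ (φ q.1 q.2.2)) *
      (H q.2.1 * starRingEnd ℂ (H q.2.2))) (μ.prod (ν.prod ν)) := by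
    have h1 := hb.mul_prod hHH.norm
    refine h1.mono (hφφ.aestronglyMeasurable.mul ?_) (Filter.Eventually.of_forall fun q => ?_)
    · exact hHH.1.comp_quasiMeasurePreserving Measure.quasiMeasurePreserving_snd
    · have hb0 : ∀ x, ∀ _ : Y, 0 ≤ b x := fun x y => (norm_nonneg _).trans (hφb x y)
      simp only [norm_mul, norm_norm, RCLike.norm_conj, norm_pow]
      rw [Real.norm_of_nonneg (hb0 q.1 q.2.1), sq]
      gcongr
      · exact hb0 _ q.2.1
      · exact hφb _ _
      · exact hφb _ _
  have hvv : ∀ x, ((‖v x‖ ^ 2 : ℝ) : ℂ) = ∫ p : Y × Y, (φ x p.1 * starRingEnd ℂ (φ x p.2)) *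
      (H p.1 * starRingEnd ℂ (H p.2)) ∂(ν.prod ν) := by
    intro x
    have : ((‖v x‖ ^ 2 : ℝ) : ℂ) = v x * starRingEnd ℂ (v x) := by
      rw [Complex.mul_conj, Complex.normSq_eq_norm_sq]
    rw [this, hv]
    simp only
    rw [← integral_conj, ← integral_prod_mul]
    congr 1
    ext p
    simp only [map_mul]
    ring
  have hvint : Integrable (fun x => ((‖v x‖ ^ 2 : ℝ) : ℂ)) μ := by
    simp_rw [hvv]
    exact h_int.integral_prod_left
  have hswap : ∫ x, ((‖v x‖ ^ 2 : ℝ) : ℂ) ∂μ =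
      ∫ p, K p * (H p.1 * starRingEnd ℂ (H p.2)) ∂(ν.prod ν) := by
    simp_rw [hvv]
    rw [integral_integral_swap h_int]
    congr 1
    ext p
    rw [integral_mul_const]
  have hsym : ∀ y y', ‖K (y, y')‖ₑ = ‖K (y', y)‖ₑ := by
    intro y y'
    have : K (y, y') = starRingEnd ℂ (K (y', y)) := by
      simp only [hKdef]
      rw [← integral_conj]
      congr 1
      ext x
      simp [mul_comm]
    rw [this, RCLike.enorm_conj]
  have hHm : AEMeasurable (fun y => ‖H y‖ₑ ^ 2) ν := hH.1.enorm.pow_const 2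
  set k : Y × Y → ℝ≥0∞ := (S ×ˢ S).indicator fun p => ‖K p‖ₑ with hk
  have hkm : Measurable k := hKm.enorm.indicator (hS.prod hS)
  have hksym : ∀ y y', k (y, y') = k (y', y) := by
    intro y y'
    by_cases h1 : y ∈ S <;> by_cases h2 : y' ∈ S <;> simp [hk, h1, h2, hsym y y']
  have hkB : ∀ y, ∫⁻ y', k (y, y') ∂ν ≤ B := by
    intro y
    by_cases h1 : y ∈ S
    · refine le_trans (le_of_eq ?_) (hK y h1)
      rw [← lintegral_indicator hS]
      congr 1
      ext y'
      by_cases h2 : y' ∈ S <;> simp [hk, h1, h2, hKdef]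
    · simp [hk, h1]
  have hHk : AEMeasurable (fun p : Y × Y => ‖H p.1‖ₑ ^ 2 * k p) (ν.prod ν) :=
    (hHm.comp_quasiMeasurePreserving Measure.quasiMeasurePreserving_fst).mul hkm.aemeasurable
  have h1 : ∫⁻ p : Y × Y, ‖H p.1‖ₑ ^ 2 * k p ∂(ν.prod ν) ≤ B * ∫⁻ y, ‖H y‖ₑ ^ 2 ∂ν := by
    rw [lintegral_prod _ hHk]
    rw [← lintegral_const_mul'' _ hHm]
    refine lintegral_mono fun y => ?_
    simp only
    rw [lintegral_const_mul _ (show Measurable fun y' => k (y, y') from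
      hkm.comp measurable_prodMk_left), mul_comm]
    gcongr
    exact hkB y
  have h2 : ∫⁻ p : Y × Y, ‖H p.2‖ₑ ^ 2 * k p ∂(ν.prod ν) ≤ B * ∫⁻ y, ‖H y‖ₑ ^ 2 ∂ν := by
    refine le_trans (le_of_eq ?_) h1
    rw [← lintegral_prod_swap]
    congr 1
    ext p
    simp [Prod.swap, hksym p.1 p.2]
  calc ∫⁻ x, ‖v x‖ₑ ^ 2 ∂μ = ∫⁻ x, ‖(‖v x‖ ^ 2 : ℝ)‖ₑ ∂μ := by
        congr 1
        ext x
        simp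
    _ = ‖∫ x, ((‖v x‖ ^ 2 : ℝ) : ℂ) ∂μ‖ₑ := by
        have hr : Integrable (fun x => ‖v x‖ ^ 2) μ := hvint.re
        rw [← ofReal_integral_norm_eq_lintegral_enorm hr]
        simp only [norm_pow, norm_norm]
        rw [← ofReal_norm]
        congr 1
        have h3 : ∫ x, ((‖v x‖ ^ 2 : ℝ) : ℂ) ∂μ = ((∫ x, ‖v x‖ ^ 2 ∂μ : ℝ) : ℂ) := integral_ofReal
        rw [h3, Complex.norm_real, Real.norm_of_nonneg]
        positivity
    _ = ‖∫ p, K p * (H p.1 * starRingEnd ℂ (H p.2)) ∂(ν.prod ν)‖ₑ := by rw [hswap]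
    _ ≤ ∫⁻ p, ‖K p * (H p.1 * starRingEnd ℂ (H p.2))‖ₑ ∂(ν.prod ν) :=
        enorm_integral_le_lintegral_enorm _
    _ ≤ ∫⁻ p, (‖H p.1‖ₑ ^ 2 * k p + ‖H p.2‖ₑ ^ 2 * k p) ∂(ν.prod ν) := by
        refine lintegral_mono fun p => ?_
        simp only
        by_cases hp1 : p.1 ∈ S
        · by_cases hp2 : p.2 ∈ S
          · have hkp : k p = ‖K p‖ₑ := by simp [hk, hp1, hp2, Set.mem_prod]
            rw [hkp, enorm_mul, enorm_mul, RCLike.enorm_conj, ← add_mul, mul_comm]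
            gcongr
            rcases le_total ‖H p.1‖ₑ ‖H p.2‖ₑ with h | h
            · refine le_add_left ?_
              rw [sq]; gcongr
            · refine le_add_right ?_
              rw [sq]; gcongr
          · simp [hHS _ hp2]
        · simp [hHS _ hp1]
    _ ≤ _ := by
        rw [lintegral_add_left' hHk]
        calc _ ≤ _ := add_le_add h1 h2
          _ = _ := by ring

/-- Integration in polar coordinates on `ℝ⁴`. -/
lemma lintegral_polar {F : Sp → ℝ≥0∞} (hF : Measurable F) :
    ∫⁻ x, F x = ∫⁻ ω : Metric.sphere (0 : Sp) 1, (∫⁻ ρ in Set.Ioi (0 : ℝ),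
      ENNReal.ofReal (ρ ^ 3) * F (ρ • (ω : Sp))) ∂(volume : Measure Sp).toSphere := by
  have hmp := (volume : Measure Sp).measurePreserving_homeomorphUnitSphereProd
  have hdim : Module.finrank ℝ Sp - 1 = 3 := by simp [Sp]
  rw [hdim] at hmp
  have h1 := hmp.lintegral_comp_emb (Homeomorph.measurableEmbedding _)
    (fun p => F ((p.2 : ℝ) • (p.1 : Sp)))
  have h2 : ∀ x : ({0}ᶜ : Set Sp), F (((homeomorphUnitSphereProd Sp x).2 : ℝ) •
      ((homeomorphUnitSphereProd Sp x).1 : Sp)) = F x := by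
    intro x
    have hx : ‖(x : Sp)‖ ≠ 0 := norm_ne_zero_iff.2 x.2
    simp [smul_smul, hx]
  simp_rw [h2] at h1
  rw [← setLIntegral_univ, ← Set.union_compl_self {(0 : Sp)}]
  rw [lintegral_union (measurableSet_singleton _).compl (disjoint_compl_right)]
  simp only [Measure.restrict_singleton, measure_singleton, zero_smul,
    lintegral_zero_measure, zero_add]
  rw [← lintegral_subtype_comap (measurableSet_singleton _).compl, h1]
  have hm : Measurable fun p : Metric.sphere (0 : Sp) 1 × Set.Ioi (0 : ℝ) =>
      F ((p.2 : ℝ) • (p.1 : Sp)) := by fun_prop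
  rw [lintegral_prod _ hm.aemeasurable]
  congr 1
  ext ω
  rw [Measure.volumeIoiPow, lintegral_withDensity_eq_lintegral_mul₀ (by fun_prop)
    (by fun_prop)]
  exact lintegral_subtype_comap measurableSet_Ioi
    (fun ρ : ℝ => ENNReal.ofReal (ρ ^ 3) * F (ρ • (ω : Sp)))

lemma norm_sub_smul_sq {e ω : Sp} (he : ‖e‖ = 1) (hω : ‖ω‖ = 1) (r ρ : ℝ) :
    ‖ρ • ω - r • e‖ ^ 2 = (ρ - r) ^ 2 + ρ * r * ‖ω - e‖ ^ 2 := by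
  rw [norm_sub_sq_real, norm_sub_sq_real, inner_smul_left, inner_smul_right, norm_smul, norm_smul,
    he, hω]
  simp only [Real.norm_eq_abs, mul_one, sq_abs, conj_trivial]
  ring

lemma integral_gauss_four {b : ℝ} (hb : 0 < b) :
    ∫⁻ v : Sp, ENNReal.ofReal (Real.exp (-b * ‖v‖ ^ 2)) = ENNReal.ofReal ((Real.pi / b) ^ 2) := by
  have h := GaussianFourier.integral_rexp_neg_mul_sq_norm (V := Sp) hb
  have hi : Integrable (fun v : Sp => Real.exp (-b * ‖v‖ ^ 2)) := by
    by_contra hn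
    rw [integral_undef hn] at h
    have : 0 < (Real.pi / b) ^ (Module.finrank ℝ Sp / 2 : ℝ) := by positivity
    linarith
  rw [← ofReal_integral_eq_lintegral_ofReal hi (.of_forall fun _ => by positivity), h]
  congr 1
  rw [← Real.rpow_natCast]
  congr 1
  simp [Sp]
  norm_num

/-- The concentration of Gaussians on the unit sphere of `ℝ⁴`. -/
lemma lintegral_sphere_gauss_le : ∃ C : ℝ≥0∞, C ≠ ∞ ∧ ∀ e : Sp, ‖e‖ = 1 → ∀ R : ℝ, 1 ≤ R →
    ENNReal.ofReal (R ^ 3) * ∫⁻ ω : Metric.sphere (0 : Sp) 1,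
      ENNReal.ofReal (Real.exp (-(Real.pi / 4) * R ^ 2 * ‖(ω : Sp) - e‖ ^ 2))
        ∂(volume : Measure Sp).toSphere ≤ C := by
  refine ⟨ENNReal.ofReal (Real.exp (Real.pi / 8)) *
    ENNReal.ofReal ((Real.pi / (Real.pi / 8)) ^ 2), by finiteness, fun e he R hR => ?_⟩
  have h := integral_gauss_four (b := Real.pi / 8) (by positivity)
  rw [← lintegral_sub_right_eq_self _ (R • e), lintegral_polar (by fun_prop)] at h
  rw [← h, ← lintegral_const_mul _ (by fun_prop), ← lintegral_const_mul' _ _ (by finiteness)]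
  refine lintegral_mono fun ω => ?_
  have hω : ‖(ω : Sp)‖ = 1 := by simp
  calc ENNReal.ofReal (R ^ 3) *
        ENNReal.ofReal (Real.exp (-(Real.pi / 4) * R ^ 2 * ‖(ω : Sp) - e‖ ^ 2))
      = ∫⁻ ρ in Set.Ioo R (R + 1), ENNReal.ofReal (R ^ 3) *
        ENNReal.ofReal (Real.exp (-(Real.pi / 4) * R ^ 2 * ‖(ω : Sp) - e‖ ^ 2)) := by simp
    _ ≤ ∫⁻ ρ in Set.Ioo R (R + 1), ENNReal.ofReal (Real.exp (Real.pi / 8)) *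
        (ENNReal.ofReal (ρ ^ 3) *
          ENNReal.ofReal (Real.exp (-(Real.pi / 8) * ‖ρ • (ω : Sp) - R • e‖ ^ 2))) := by
        refine setLIntegral_mono' measurableSet_Ioo fun ρ hρ => ?_
        rw [mul_left_comm, ← ENNReal.ofReal_mul (p := Real.exp (Real.pi / 8)) (by positivity), ← Real.exp_add]
        gcongr
        · exact hρ.1.le
        · rw [norm_sub_smul_sq he hω]
          have h1 : (ρ - R) ^ 2 ≤ 1 := by
            have := hρ.1; have := hρ.2; nlinarith
          have h2 : ρ * R ≤ 2 * R ^ 2 := by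
            have := hρ.1; have := hρ.2; nlinarith
          have h3 := mul_le_mul_of_nonneg_right h2 (sq_nonneg ‖(ω : Sp) - e‖)
          have h4 := Real.pi_pos
          nlinarith
    _ ≤ ∫⁻ ρ in Set.Ioi 0, ENNReal.ofReal (Real.exp (Real.pi / 8)) *
        (ENNReal.ofReal (ρ ^ 3) *
          ENNReal.ofReal (Real.exp (-(Real.pi / 8) * ‖ρ • (ω : Sp) - R • e‖ ^ 2))) := by
        refine lintegral_mono_set fun ρ hρ => ?_
        have := hρ.1
        simp only [Set.mem_Ioi]; linarith
    _ = _ := lintegral_const_mul' _ _ (by finiteness)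

/-- The superposition of half-waves with Fourier data `H`. -/
def wave (H : Sp → ℂ) (t : ℝ) (x : Sp) : ℂ :=
  ∫ ξ : Sp, Complex.exp (2 * Real.pi * Complex.I * ((t * ‖ξ‖ + ⟪x, ξ⟫ : ℝ) : ℂ)) * H ξ

/-- The closed annulus of unit frequencies. -/
def unitAnnulus : Set Sp := {ξ | 1 / 2 ≤ ‖ξ‖ ∧ ‖ξ‖ ≤ 2}

lemma measurableSet_unitAnnulus : MeasurableSet unitAnnulus :=
  (measurableSet_le measurable_const measurable_norm).inter
    (measurableSet_le measurable_norm measurable_const)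

lemma enorm_integral_gauss_real {T : ℝ} (hT : 0 < T) (s : ℝ) :
    ‖∫ t : ℝ, cexp (-(Real.pi / T ^ 2 : ℝ) * ‖t‖ ^ 2 + (2 * Real.pi * I) * ⟪s, t⟫)‖ₑ =
      ENNReal.ofReal (T * Real.exp (-Real.pi * T ^ 2 * s ^ 2)) := by
  have hb : 0 < ((Real.pi / T ^ 2 : ℝ) : ℂ).re := by rw [ofReal_re]; positivity
  rw [GaussianFourier.integral_cexp_neg_mul_sq_norm_add hb, ← ofReal_norm]
  congr 1
  have h1 : (Real.pi : ℂ) / ((Real.pi / T ^ 2 : ℝ) : ℂ) = ((T ^ 2 : ℝ) : ℂ) := by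
    have := Real.pi_ne_zero
    push_cast; field_simp
  have h2 : (2 * Real.pi * I) ^ 2 * (‖s‖ : ℂ) ^ 2 / (4 * ((Real.pi / T ^ 2 : ℝ) : ℂ)) =
      ((-Real.pi * T ^ 2 * s ^ 2 : ℝ) : ℂ) := by
    have := Real.pi_ne_zero
    have h3 : (‖s‖ : ℂ) ^ 2 = (s : ℂ) ^ 2 := by
      norm_cast; simp
    rw [h3, mul_pow, I_sq]
    push_cast; field_simp; ring
  rw [h1, h2, norm_mul, ← ofReal_exp, norm_real, Real.norm_of_nonneg (Real.exp_pos _).le]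
  congr 1
  rw [norm_cpow_eq_rpow_re_of_pos (by positivity)]
  have h4 : ((Module.finrank ℝ ℝ : ℂ) / 2).re = 1 / 2 := by norm_num
  rw [h4, ← Real.sqrt_eq_rpow, Real.sqrt_sq hT.le]

lemma enorm_integral_gauss_four {R : ℝ} (hR : 0 < R) (s : Sp) :
    ‖∫ x : Sp, cexp (-(Real.pi / R ^ 2 : ℝ) * ‖x‖ ^ 2 + (2 * Real.pi * I) * ⟪s, x⟫)‖ₑ =
      ENNReal.ofReal (R ^ 4 * Real.exp (-Real.pi * R ^ 2 * ‖s‖ ^ 2)) := by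
  have hb : 0 < ((Real.pi / R ^ 2 : ℝ) : ℂ).re := by rw [ofReal_re]; positivity
  rw [GaussianFourier.integral_cexp_neg_mul_sq_norm_add hb, ← ofReal_norm]
  congr 1
  have h1 : (Real.pi : ℂ) / ((Real.pi / R ^ 2 : ℝ) : ℂ) = ((R ^ 2 : ℝ) : ℂ) := by
    have := Real.pi_ne_zero
    push_cast; field_simp
  have h2 : (2 * Real.pi * I) ^ 2 * (‖s‖ : ℂ) ^ 2 / (4 * ((Real.pi / R ^ 2 : ℝ) : ℂ)) =
      ((-Real.pi * R ^ 2 * ‖s‖ ^ 2 : ℝ) : ℂ) := by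
    have := Real.pi_ne_zero
    rw [mul_pow, I_sq]
    push_cast; field_simp; ring
  rw [h1, h2, norm_mul, ← ofReal_exp, norm_real, Real.norm_of_nonneg (Real.exp_pos _).le]
  congr 1
  rw [norm_cpow_eq_rpow_re_of_pos (by positivity)]
  have h4 : ((Module.finrank ℝ Sp : ℂ) / 2).re = (2 : ℕ) := by simp [Sp]; norm_num
  rw [h4, Real.rpow_natCast]
  ring

/-- The Schur bound for the space-time Gaussian kernel. -/
lemma lintegral_kernel_le : ∃ C : ℝ≥0∞, C ≠ ∞ ∧ ∀ T R : ℝ, 0 < T → 1 ≤ R → ∀ ξ ∈ unitAnnulus,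
    ∫⁻ η in unitAnnulus, ENNReal.ofReal (T * Real.exp (-Real.pi * T ^ 2 * (‖ξ‖ - ‖η‖) ^ 2)) *
      ENNReal.ofReal (R ^ 4 * Real.exp (-Real.pi * R ^ 2 * ‖ξ - η‖ ^ 2)) ≤
    C * ENNReal.ofReal R := by
  obtain ⟨C, hC, hsph⟩ := lintegral_sphere_gauss_le
  refine ⟨8 * C, by finiteness, fun T R hT hR ξ hξ => ?_⟩
  have hr : 0 < ‖ξ‖ := by have := hξ.1; linarith
  set r := ‖ξ‖ with hrdef
  set e : Sp := r⁻¹ • ξ with hedef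
  have he : ‖e‖ = 1 := by
    rw [hedef, norm_smul, norm_inv, norm_norm, ← hrdef, inv_mul_cancel₀ hr.ne']
  have hξe : ξ = r • e := by rw [hedef, smul_smul, mul_inv_cancel₀ hr.ne', one_smul]
  have hgauss : ∫⁻ ρ : ℝ, ENNReal.ofReal (T * Real.exp (-Real.pi * T ^ 2 * (r - ρ) ^ 2)) = 1 := by
    have h0 : ∫⁻ ρ : ℝ, ENNReal.ofReal (T * Real.exp (-Real.pi * T ^ 2 * (r - ρ) ^ 2)) =
        ∫⁻ ρ : ℝ, ENNReal.ofReal (T * Real.exp (-(Real.pi * T ^ 2) * ρ ^ 2)) := by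
      rw [← lintegral_sub_left_eq_self _ r]
      simp only [neg_mul, sub_sub_cancel]
    rw [h0, ← ofReal_integral_eq_lintegral_ofReal
      ((integrable_exp_neg_mul_sq (by positivity)).const_mul T) (.of_forall fun _ => by positivity),
      integral_const_mul, integral_gaussian]
    have : Real.pi / (Real.pi * T ^ 2) = (T⁻¹) ^ 2 := by
      have := Real.pi_ne_zero
      field_simp
    rw [this, Real.sqrt_sq (by positivity), mul_inv_cancel₀ hT.ne', ENNReal.ofReal_one]
  rw [← lintegral_indicator measurableSet_unitAnnulus, lintegral_polar
    (Measurable.indicator (by fun_prop) measurableSet_unitAnnulus)]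
  calc _ ≤ ∫⁻ ω : Metric.sphere (0 : Sp) 1, (∫⁻ ρ in Set.Ioi (0 : ℝ),
        8 * ENNReal.ofReal (T * Real.exp (-Real.pi * T ^ 2 * (r - ρ) ^ 2)) *
        (ENNReal.ofReal (R ^ 4) *
          ENNReal.ofReal (Real.exp (-(Real.pi / 4) * R ^ 2 * ‖(ω : Sp) - e‖ ^ 2))))
        ∂(volume : Measure Sp).toSphere := by
        refine lintegral_mono fun ω => setLIntegral_mono' measurableSet_Ioi fun ρ hρ => ?_
        have hω : ‖(ω : Sp)‖ = 1 := by simp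
        have hρ0 : 0 < ρ := hρ
        by_cases hmem : ρ • (ω : Sp) ∈ unitAnnulus
        · rw [Set.indicator_of_mem hmem]
          have hρn : ‖ρ • (ω : Sp)‖ = ρ := by
            rw [norm_smul, hω, mul_one, Real.norm_of_nonneg hρ0.le]
          have h1 : 1 / 2 ≤ ρ := hρn ▸ hmem.1
          have h2 : ρ ≤ 2 := hρn ▸ hmem.2
          rw [hρn, ← mul_assoc]
          gcongr
          · rw [show (8 : ℝ≥0∞) = ENNReal.ofReal 8 by simp]
            gcongr
            calc ρ ^ 3 ≤ 2 ^ 3 := by gcongr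
              _ = 8 := by norm_num
          · rw [← ENNReal.ofReal_mul (by positivity)]
            refine ENNReal.ofReal_le_ofReal (mul_le_mul_of_nonneg_left
              (Real.exp_le_exp.2 ?_) (by positivity))
            rw [norm_sub_rev, hξe, norm_sub_smul_sq he hω]
            have h3 : 1 / 4 ≤ ρ * r := by
              have := hξ.1; nlinarith
            have h4 := Real.pi_pos
            have h5 : 1 / 4 * ‖(ω : Sp) - e‖ ^ 2 ≤ (ρ - r) ^ 2 + ρ * r * ‖(ω : Sp) - e‖ ^ 2 := by
              nlinarith [mul_le_mul_of_nonneg_right h3 (sq_nonneg ‖(ω : Sp) - e‖),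
                sq_nonneg (ρ - r)]
            have h6 := mul_le_mul_of_nonneg_left h5 (show 0 ≤ Real.pi * R ^ 2 by positivity)
            nlinarith
        · simp [Set.indicator_of_notMem hmem]
    _ ≤ ∫⁻ ω : Metric.sphere (0 : Sp) 1, 8 * (ENNReal.ofReal (R ^ 4) *
          ENNReal.ofReal (Real.exp (-(Real.pi / 4) * R ^ 2 * ‖(ω : Sp) - e‖ ^ 2)))
        ∂(volume : Measure Sp).toSphere := by
        refine lintegral_mono fun ω => ?_
        simp only
        rw [lintegral_mul_const' _ _ (by finiteness), lintegral_const_mul' _ _ (by finiteness)]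
        gcongr
        calc _ ≤ (8 : ℝ≥0∞) * 1 := by
              gcongr
              exact (setLIntegral_le_lintegral _ _).trans hgauss.le
          _ = 8 := mul_one _
    _ = 8 * (ENNReal.ofReal R * (ENNReal.ofReal (R ^ 3) * ∫⁻ ω : Metric.sphere (0 : Sp) 1,
          ENNReal.ofReal (Real.exp (-(Real.pi / 4) * R ^ 2 * ‖(ω : Sp) - e‖ ^ 2))
        ∂(volume : Measure Sp).toSphere)) := by
        rw [lintegral_const_mul' _ _ (by finiteness), lintegral_const_mul' _ _ (by finiteness),
          ← mul_assoc (ENNReal.ofReal R), ← ENNReal.ofReal_mul (by positivity)]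
        ring_nf
    _ ≤ 8 * (ENNReal.ofReal R * C) := by
        gcongr
        exact hsph e he R hR
    _ = _ := by ring

lemma measurable_wave {H : Sp → ℂ} (hH : Measurable H) :
    Measurable fun p : ℝ × Sp => wave H p.1 p.2 := by
  have : StronglyMeasurable (Function.uncurry fun (p : ℝ × Sp) (ξ : Sp) =>
      cexp (2 * Real.pi * I * ((p.1 * ‖ξ‖ + ⟪p.2, ξ⟫ : ℝ) : ℂ)) * H ξ) := by
    refine Measurable.stronglyMeasurable ?_
    refine Measurable.mul ?_ (hH.comp measurable_snd)
    exact Continuous.measurable (by fun_prop)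
  exact this.integral_prod_right.measurable

lemma lintegral_gauss_wave_le : ∃ C : ℝ≥0∞, C ≠ ∞ ∧ ∀ H : Sp → ℂ, Integrable H →
    (∀ ξ, ξ ∉ unitAnnulus → H ξ = 0) → ∀ T R : ℝ, 0 < T → 1 ≤ R →
    ∫⁻ p : ℝ × Sp, ENNReal.ofReal (Real.exp (-Real.pi * (p.1 ^ 2 / T ^ 2 + ‖p.2‖ ^ 2 / R ^ 2))) *
      ‖wave H p.1 p.2‖ₑ ^ 2 ≤ C * ENNReal.ofReal R * ∫⁻ ξ, ‖H ξ‖ₑ ^ 2 := by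
  obtain ⟨C, hC, hker⟩ := lintegral_kernel_le
  refine ⟨2 * C, by finiteness, fun H hH hHS T R hT hR => ?_⟩
  have hR0 : 0 < R := by linarith
  set b : ℝ × Sp → ℝ := fun p =>
    Real.exp (-(Real.pi / 2) * (p.1 ^ 2 / T ^ 2 + ‖p.2‖ ^ 2 / R ^ 2)) with hb
  set φ : ℝ × Sp → Sp → ℂ := fun p ξ =>
    (b p : ℂ) * cexp (2 * Real.pi * I * ((p.1 * ‖ξ‖ + ⟪p.2, ξ⟫ : ℝ) : ℂ)) with hφ
  have hbsq : ∀ p, b p ^ 2 =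
      Real.exp (-Real.pi * (p.1 ^ 2 / T ^ 2 + ‖p.2‖ ^ 2 / R ^ 2)) := by
    intro p
    rw [hb, ← Real.exp_nat_mul]
    congr 1
    push_cast; ring
  have hphase : ∀ (p : ℝ × Sp) (ξ : Sp),
      ‖cexp (2 * Real.pi * I * ((p.1 * ‖ξ‖ + ⟪p.2, ξ⟫ : ℝ) : ℂ))‖ = 1 := by
    intro p ξ
    rw [show 2 * Real.pi * I * ((p.1 * ‖ξ‖ + ⟪p.2, ξ⟫ : ℝ) : ℂ) =
      ((2 * Real.pi * (p.1 * ‖ξ‖ + ⟪p.2, ξ⟫) : ℝ) : ℂ) * I by push_cast; ring]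
    exact norm_exp_ofReal_mul_I _
  have hbint : Integrable (fun p => b p ^ 2) (volume : Measure (ℝ × Sp)) := by
    have h1 : Integrable fun t : ℝ => Real.exp (-(Real.pi / T ^ 2) * t ^ 2) :=
      integrable_exp_neg_mul_sq (by positivity)
    have h2 : Integrable fun x : Sp => Real.exp (-(Real.pi / R ^ 2) * ‖x‖ ^ 2) := by
      refine ⟨(by fun_prop), ?_⟩
      have h := integral_gauss_four (b := Real.pi / R ^ 2) (by positivity)
      rw [HasFiniteIntegral]
      have h3 : ∀ x : Sp, ‖Real.exp (-(Real.pi / R ^ 2) * ‖x‖ ^ 2)‖ₑ =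
          ENNReal.ofReal (Real.exp (-(Real.pi / R ^ 2) * ‖x‖ ^ 2)) := fun x =>
        Real.enorm_of_nonneg (Real.exp_pos _).le
      simp_rw [h3, h]
      exact ENNReal.ofReal_lt_top
    refine (h1.mul_prod h2).congr (.of_forall fun p => ?_)
    simp only
    rw [hbsq, ← Real.exp_add]
    congr 1
    ring
  have hφm : Measurable (Function.uncurry φ) := by
    refine Continuous.measurable ?_
    simp only [hφ, hb, Function.uncurry_def]
    fun_prop
  have hφb : ∀ p ξ, ‖φ p ξ‖ ≤ b p := by
    intro p ξ
    rw [hφ, norm_mul, hphase, mul_one, norm_real, Real.norm_of_nonneg (Real.exp_pos _).le]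
  have hmain := lintegral_enorm_sq_le_of_schur (ν := volume) hφm hbint hφb hH
    measurableSet_unitAnnulus hHS (B := C * ENNReal.ofReal R) ?_
  · calc _ = ∫⁻ p, ‖∫ ξ, φ p ξ * H ξ‖ₑ ^ 2 := by
          congr 1
          ext p
          have : ∫ ξ, φ p ξ * H ξ = (b p : ℂ) * wave H p.1 p.2 := by
            rw [wave, ← integral_const_mul]
            congr 1
            ext ξ
            simp only [hφ]
            ring
          rw [this, enorm_mul, mul_pow, ← hbsq]
          congr 1
          rw [ENNReal.ofReal_pow (Real.exp_pos _).le]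
          congr 1
          rw [← ofReal_norm, norm_real, Real.norm_of_nonneg (Real.exp_pos _).le]
      _ ≤ _ := hmain
      _ = _ := by ring
  · intro ξ hξ
    refine le_trans (le_of_eq ?_) (hker T R hT hR ξ hξ)
    congr 1
    ext η
    rw [← enorm_integral_gauss_real hT, ← enorm_integral_gauss_four hR0, ← enorm_mul,
      ← integral_prod_mul]
    congr 2
    ext p
    simp only [hφ, map_mul, conj_ofReal, ← exp_conj]
    rw [mul_mul_mul_comm, ← Complex.exp_add, ← Complex.exp_add, hb, ← ofReal_mul, ← Real.exp_add,
      ofReal_exp, ← Complex.exp_add]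
    congr 1
    simp only [real_inner_comm p.2, inner_sub_right, RCLike.inner_apply, conj_trivial]
    have h5 : (‖p.1‖ : ℂ) ^ 2 = (p.1 : ℂ) ^ 2 := by norm_cast; simp
    rw [h5]
    simp [map_ofNat]
    ring

/-- Local energy decay: a wave of unit frequency spends time at most `O(R)` in a ball of
radius `R`. -/
lemma lintegral_ball_wave_le : ∃ C : ℝ≥0∞, C ≠ ∞ ∧ ∀ H : Sp → ℂ, Measurable H → Integrable H →
    (∀ ξ, ξ ∉ unitAnnulus → H ξ = 0) → ∀ R : ℝ, 1 ≤ R →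
    ∫⁻ p : ℝ × Sp, (Metric.closedBall (0 : Sp) R).indicator 1 p.2 * ‖wave H p.1 p.2‖ₑ ^ 2 ≤
      C * ENNReal.ofReal R * ∫⁻ ξ, ‖H ξ‖ₑ ^ 2 := by
  obtain ⟨C, hC, h⟩ := lintegral_gauss_wave_le
  refine ⟨ENNReal.ofReal (Real.exp (2 * Real.pi)) * C, by finiteness, fun H hm hH hHS R hR => ?_⟩
  set S : ℕ → Set (ℝ × Sp) := fun n => {p | |p.1| ≤ n + 1} with hS
  have hSm : ∀ n, MeasurableSet (S n) := fun n =>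
    measurableSet_le (by fun_prop) measurable_const
  have hmono : Monotone S := by
    intro m n hmn p hp
    have : (m : ℝ) ≤ n := by exact_mod_cast hmn
    simp only [hS, Set.mem_ofPred_eq] at hp ⊢
    linarith
  have hU : ⋃ n, S n = Set.univ := by
    refine Set.eq_univ_of_forall fun p => Set.mem_iUnion.2 ⟨⌈|p.1|⌉₊, ?_⟩
    simp only [hS, Set.mem_ofPred_eq]
    linarith [Nat.le_ceil |p.1|]
  rw [← setLIntegral_univ, ← hU, setLIntegral_iUnion_of_directed _ hmono.directed_le]
  refine iSup_le fun n => ?_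
  have hT : (0 : ℝ) < n + 1 := by positivity
  calc _ ≤ ∫⁻ p in S n, ENNReal.ofReal (Real.exp (2 * Real.pi)) * (ENNReal.ofReal (Real.exp
        (-Real.pi * (p.1 ^ 2 / (n + 1 : ℝ) ^ 2 + ‖p.2‖ ^ 2 / R ^ 2))) *
          ‖wave H p.1 p.2‖ₑ ^ 2) := by
        refine setLIntegral_mono' (hSm n) fun p hp => ?_
        rw [← mul_assoc]
        gcongr
        by_cases hb : p.2 ∈ Metric.closedBall (0 : Sp) R
        · rw [Set.indicator_of_mem hb, ← ENNReal.ofReal_mul (by positivity), ← Real.exp_add,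
            Pi.one_apply, ← ENNReal.ofReal_one]
          refine ENNReal.ofReal_le_ofReal (Real.one_le_exp ?_)
          have h1 : p.1 ^ 2 / (n + 1 : ℝ) ^ 2 ≤ 1 := by
            rw [div_le_one (by positivity), ← sq_abs]
            have : |p.1| ≤ n + 1 := hp
            gcongr
          have h2 : ‖p.2‖ ^ 2 / R ^ 2 ≤ 1 := by
            rw [div_le_one (by positivity)]
            have : ‖p.2‖ ≤ R := by simpa using hb
            gcongr
          nlinarith [Real.pi_pos]
        · simp [Set.indicator_of_notMem hb]
    _ ≤ ∫⁻ p : ℝ × Sp, ENNReal.ofReal (Real.exp (2 * Real.pi)) * (ENNReal.ofReal (Real.exp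
        (-Real.pi * (p.1 ^ 2 / (n + 1 : ℝ) ^ 2 + ‖p.2‖ ^ 2 / R ^ 2))) *
          ‖wave H p.1 p.2‖ₑ ^ 2) := setLIntegral_le_lintegral _ _
    _ ≤ _ := by
        rw [lintegral_const_mul' _ _ (by finiteness), mul_assoc, mul_assoc]
        gcongr
        rw [← mul_assoc]
        exact h H hH hHS _ R hT hR

/-- Weighted local energy decay. -/
lemma lintegral_weight_wave_le {a : ℝ} (ha : 1 < a) : ∃ C : ℝ≥0∞, C ≠ ∞ ∧ ∀ H : Sp → ℂ,
    Measurable H → Integrable H → (∀ ξ, ξ ∉ unitAnnulus → H ξ = 0) →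
    ∫⁻ p : ℝ × Sp, ENNReal.ofReal ((1 + ‖p.2‖) ^ (-a)) * ‖wave H p.1 p.2‖ₑ ^ 2 ≤
      C * ∫⁻ ξ, ‖H ξ‖ₑ ^ 2 := by
  obtain ⟨C, hC, h⟩ := lintegral_ball_wave_le
  have ha0 : 0 ≤ a := by linarith
  set q : ℝ≥0∞ := ENNReal.ofReal ((2 : ℝ) ^ (1 - a)) with hq
  have hq1 : q < 1 := by
    rw [hq, ← ENNReal.ofReal_one]
    refine ENNReal.ofReal_lt_ofReal_iff_of_nonneg (by positivity) |>.2 ?_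
    exact Real.rpow_lt_one_of_one_lt_of_neg (by norm_num) (by linarith)
  refine ⟨ENNReal.ofReal (2 ^ a) * (1 - q)⁻¹ * C, ?_, fun H hm hH hHS => ?_⟩
  · have : (1 - q)⁻¹ ≠ ∞ := by
      rw [ENNReal.inv_ne_top]
      exact (tsub_pos_of_lt hq1).ne'
    finiteness
  have hW : ∀ x : Sp, ENNReal.ofReal ((1 + ‖x‖) ^ (-a)) ≤ ∑' m : ℕ,
      ENNReal.ofReal (2 ^ a * ((2 : ℝ) ^ (-a)) ^ m) *
        (Metric.closedBall (0 : Sp) (2 ^ m)).indicator 1 x := by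
    intro x
    have hex : ∃ m : ℕ, 1 + ‖x‖ ≤ 2 ^ m := by
      obtain ⟨m, hm⟩ := pow_unbounded_of_one_lt (1 + ‖x‖) (show (1 : ℝ) < 2 by norm_num)
      exact ⟨m, hm.le⟩
    classical
    obtain ⟨m, hm, hmin⟩ : ∃ m : ℕ, 1 + ‖x‖ ≤ 2 ^ m ∧ (2 : ℝ) ^ m ≤ 2 * (1 + ‖x‖) := by
      refine ⟨Nat.find hex, Nat.find_spec hex, ?_⟩
      rcases Nat.eq_zero_or_pos (Nat.find hex) with h0 | h0
      · rw [h0]; linarith [norm_nonneg x, pow_zero (2 : ℝ)]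
      · obtain ⟨n, hn⟩ := Nat.exists_eq_succ_of_ne_zero h0.ne'
        have := Nat.find_min hex (m := n) (by omega)
        rw [hn, Nat.succ_eq_add_one, pow_succ]
        linarith
    refine le_trans ?_ (ENNReal.le_tsum m)
    rw [Set.indicator_of_mem (by simp; linarith), Pi.one_apply, mul_one]
    refine ENNReal.ofReal_le_ofReal ?_
    have h1 : (0 : ℝ) < 1 + ‖x‖ := by positivity
    rw [← Real.rpow_natCast, ← Real.rpow_mul (by norm_num), mul_comm (-a), Real.rpow_mul
      (by norm_num), Real.rpow_natCast]
    calc (1 + ‖x‖) ^ (-a) ≤ ((2 : ℝ) ^ m / 2) ^ (-a) :=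
          Real.rpow_le_rpow_of_nonpos (by positivity) (by linarith) (by linarith)
      _ = _ := by
          rw [Real.div_rpow (by positivity) (by norm_num), Real.rpow_neg (by norm_num : (0:ℝ) ≤ 2),
            div_inv_eq_mul, mul_comm]
  have hm2 : Measurable fun p : ℝ × Sp => ‖wave H p.1 p.2‖ₑ ^ 2 := (measurable_wave hm).enorm.pow_const 2
  have hmi : ∀ R, Measurable fun p : ℝ × Sp =>
      (Metric.closedBall (0 : Sp) R).indicator (1 : Sp → ℝ≥0∞) p.2 := fun R =>
    (measurable_one.indicator Metric.isClosed_closedBall.measurableSet).comp measurable_snd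
  calc _ ≤ ∫⁻ p : ℝ × Sp, ∑' m : ℕ, ENNReal.ofReal (2 ^ a * ((2 : ℝ) ^ (-a)) ^ m) *
        ((Metric.closedBall (0 : Sp) (2 ^ m)).indicator 1 p.2 * ‖wave H p.1 p.2‖ₑ ^ 2) := by
        refine lintegral_mono fun p => ?_
        simp_rw [← mul_assoc]
        rw [ENNReal.tsum_mul_right]
        gcongr
        exact hW p.2
    _ = ∑' m : ℕ, ENNReal.ofReal (2 ^ a * ((2 : ℝ) ^ (-a)) ^ m) * ∫⁻ p : ℝ × Sp,
        (Metric.closedBall (0 : Sp) (2 ^ m)).indicator 1 p.2 * ‖wave H p.1 p.2‖ₑ ^ 2 := by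
        have hmm : ∀ m : ℕ, AEMeasurable (fun p : ℝ × Sp =>
            ENNReal.ofReal (2 ^ a * ((2 : ℝ) ^ (-a)) ^ m) *
              ((Metric.closedBall (0 : Sp) (2 ^ m)).indicator 1 p.2 * ‖wave H p.1 p.2‖ₑ ^ 2))
            volume := fun m => (((hmi _).mul hm2).const_mul _).aemeasurable
        rw [lintegral_tsum hmm]
        congr 1
        ext m
        rw [lintegral_const_mul' _ _ (by finiteness)]
    _ ≤ ∑' m : ℕ, ENNReal.ofReal (2 ^ a * ((2 : ℝ) ^ (-a)) ^ m) *
        (C * ENNReal.ofReal (2 ^ m) * ∫⁻ ξ, ‖H ξ‖ₑ ^ 2) := by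
        refine ENNReal.tsum_le_tsum fun m => ?_
        gcongr
        exact h H hm hH hHS _ (one_le_pow₀ (by norm_num))
    _ = ∑' m : ℕ, ENNReal.ofReal (2 ^ a) * q ^ m * (C * ∫⁻ ξ, ‖H ξ‖ₑ ^ 2) := by
        congr 1
        ext m
        have h2 : ENNReal.ofReal (2 ^ a * ((2 : ℝ) ^ (-a)) ^ m) * ENNReal.ofReal (2 ^ m) =
            ENNReal.ofReal (2 ^ a) * q ^ m := by
          rw [hq, ← ENNReal.ofReal_pow (by positivity), ← ENNReal.ofReal_mul (by positivity),
            ← ENNReal.ofReal_mul (by positivity), mul_assoc, ← mul_pow]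
          congr 4
          rw [sub_eq_neg_add, Real.rpow_add (by norm_num), Real.rpow_one]
        rw [← h2]
        ring
    _ = _ := by
        rw [ENNReal.tsum_mul_right, ENNReal.tsum_mul_left, ENNReal.tsum_geometric]
        ring

/-- The Gagliardo-Nirenberg-Sobolev inequality on `ℝ⁴`. -/
lemma lintegral_pow_four_le_fderiv : ∃ C : ℝ≥0∞, C ≠ ∞ ∧ ∀ w : Sp → ℂ, ContDiff ℝ 1 w →
    HasCompactSupport w → ∫⁻ x, ‖w x‖ₑ ^ 4 ≤ C * (∫⁻ x, ‖fderiv ℝ w x‖ₑ ^ 2) ^ 2 := by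
  refine ⟨(SNormLESNormFDerivOfEqConst ℂ (volume : Measure Sp) (2 : NNReal)) ^ 4, by finiteness,
    fun w hw hc => ?_⟩
  have h := eLpNorm_le_eLpNorm_fderiv_of_eq (volume : Measure Sp) hw hc (p := 2) (p' := 4)
    (by norm_num) (by simp [Sp]) (by simp [Sp]; norm_num)
  have h4 := eLpNorm_nnreal_pow_eq_lintegral (f := w) (μ := (volume : Measure Sp)) (p := 4)
    (by norm_num)
  have h2 := eLpNorm_nnreal_pow_eq_lintegral (f := fderiv ℝ w) (μ := (volume : Measure Sp))
    (p := 2) (by norm_num)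
  simp only [NNReal.coe_ofNat, ENNReal.rpow_ofNat] at h4 h2
  rw [← h4, ← h2, ← pow_mul, ← mul_pow]
  gcongr

/-- Comparison of integrals along a radial shift. -/
lemma lintegral_le_of_radial_shift {F G : Sp → ℝ≥0∞} (hF : Measurable F) (hG : Measurable G)
    {c : ℝ} {K : ℝ≥0∞} (hK : K ≠ ∞)
    (h : ∀ ω : Sp, ‖ω‖ = 1 → ∀ s : ℝ, 0 < s → F (s • ω) ≠ 0 → 0 < s + c ∧
      ENNReal.ofReal (s ^ 3) * F (s • ω) ≤
        K * (ENNReal.ofReal ((s + c) ^ 3) * G ((s + c) • ω))) :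
    ∫⁻ x, F x ≤ K * ∫⁻ x, G x := by
  rw [lintegral_polar hF, lintegral_polar hG, ← lintegral_const_mul' _ _ hK]
  refine lintegral_mono fun ω => ?_
  have hω : ‖(ω : Sp)‖ = 1 := by simp
  simp only
  rw [← lintegral_const_mul' _ _ hK, ← lintegral_indicator measurableSet_Ioi,
    ← lintegral_indicator measurableSet_Ioi]
  refine le_trans ?_ (lintegral_add_right_eq_self _ c).le
  refine lintegral_mono fun s => ?_
  dsimp only
  by_cases hs : 0 < s
  · rw [Set.indicator_of_mem (Set.mem_Ioi.2 hs)]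
    by_cases h0 : F (s • (ω : Sp)) = 0
    · simp [h0]
    · obtain ⟨h1, h2⟩ := h ω hω s hs h0
      rw [Set.indicator_of_mem (Set.mem_Ioi.2 h1)]
      exact h2
  · rw [Set.indicator_of_notMem (by simpa using hs)]
    exact zero_le

/-- Pointwise energy density controlling a function, its gradient and its angular derivatives. -/
def angEnergy (v : Sp → ℂ) (x : Sp) : ℝ :=
  ‖v x‖ ^ 2 + ∑ j : Fin 4, ‖fderiv ℝ v x (EuclideanSpace.single j (1 : ℝ))‖ ^ 2 +
    ∑ i : Fin 4, ∑ j : Fin 4, ‖Omega i j v x‖ ^ 2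

lemma angEnergy_nonneg (v : Sp → ℂ) (x : Sp) : 0 ≤ angEnergy v x := by
  unfold angEnergy; positivity

lemma Sp.eq_sum_single (h : Sp) : h = ∑ j : Fin 4, h j • EuclideanSpace.single j (1 : ℝ) := by
  ext k
  simp [Finset.sum_apply, Pi.single_apply]

lemma fderiv_apply_eq_sum (v : Sp → ℂ) (x h : Sp) :
    fderiv ℝ v x h = ∑ j : Fin 4, (h j : ℂ) * fderiv ℝ v x (EuclideanSpace.single j (1 : ℝ)) := by
  conv_lhs => rw [Sp.eq_sum_single h]
  simp [map_sum]

lemma norm_fderiv_apply_sq_le (v : Sp → ℂ) (x h : Sp) :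
    ‖fderiv ℝ v x h‖ ≤ ‖h‖ * (4 * √(angEnergy v x)) := by
  have hb : ∀ j : Fin 4, ‖fderiv ℝ v x (EuclideanSpace.single j (1 : ℝ))‖ ≤ √(angEnergy v x) := by
    intro j
    refine Real.le_sqrt_of_sq_le ?_
    have h1 := Finset.single_le_sum (f := fun j =>
      ‖fderiv ℝ v x (EuclideanSpace.single j (1 : ℝ))‖ ^ 2) (fun i _ => by positivity)
      (Finset.mem_univ j)
    have h2 : 0 ≤ ∑ i : Fin 4, ∑ j : Fin 4, ‖Omega i j v x‖ ^ 2 := by positivity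
    have h3 : 0 ≤ ‖v x‖ ^ 2 := by positivity
    unfold angEnergy
    linarith
  rw [fderiv_apply_eq_sum]
  calc _ ≤ ∑ j : Fin 4, ‖h‖ * √(angEnergy v x) := by
        refine norm_sum_le_of_le _ fun j _ => ?_
        rw [norm_mul, Complex.norm_real]
        exact mul_le_mul (PiLp.norm_apply_le h j) (hb j) (norm_nonneg _) (norm_nonneg _)
    _ = _ := by simp; ring

lemma norm_fderiv_tangential_le (v : Sp → ℂ) (x h : Sp) :
    ‖fderiv ℝ v x (‖x‖ ^ 2 • h - ⟪x, h⟫ • x)‖ ≤ ‖x‖ * ‖h‖ * (16 * √(angEnergy v x)) := by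
  have hb : ∀ i j : Fin 4, ‖Omega i j v x‖ ≤ √(angEnergy v x) := by
    intro i j
    refine Real.le_sqrt_of_sq_le ?_
    have h1 := Finset.single_le_sum (f := fun j => ‖Omega i j v x‖ ^ 2)
      (fun i _ => by positivity) (Finset.mem_univ j)
    have h1' := Finset.single_le_sum (f := fun i => ∑ j, ‖Omega i j v x‖ ^ 2)
      (fun i _ => by positivity) (Finset.mem_univ i)
    have h2 : 0 ≤ ∑ j : Fin 4, ‖fderiv ℝ v x (EuclideanSpace.single j (1 : ℝ))‖ ^ 2 := by
      positivity
    have h3 : 0 ≤ ‖v x‖ ^ 2 := by positivity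
    unfold angEnergy
    linarith
  have hid : fderiv ℝ v x (‖x‖ ^ 2 • h - ⟪x, h⟫ • x) =
      ∑ i : Fin 4, ∑ j : Fin 4, ((x i * h j : ℝ) : ℂ) * Omega i j v x := by
    rw [fderiv_apply_eq_sum]
    simp only [Omega, EuclideanSpace.real_norm_sq_eq, PiLp.inner_apply, Fin.sum_univ_four]
    simp
    ring
  rw [hid]
  calc _ ≤ ∑ i : Fin 4, ∑ j : Fin 4, ‖x‖ * ‖h‖ * √(angEnergy v x) := by
        refine norm_sum_le_of_le _ fun i _ => norm_sum_le_of_le _ fun j _ => ?_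
        rw [norm_mul, Complex.norm_real, norm_mul]
        gcongr
        · exact PiLp.norm_apply_le x i
        · exact PiLp.norm_apply_le h j
        · exact hb i j
    _ = _ := by simp; ring

lemma norm_le_sqrt_angEnergy (v : Sp → ℂ) (x : Sp) : ‖v x‖ ≤ √(angEnergy v x) := by
  refine Real.le_sqrt_of_sq_le ?_
  unfold angEnergy
  have h1 : 0 ≤ ∑ i : Fin 4, ∑ j : Fin 4, ‖Omega i j v x‖ ^ 2 := by positivity
  have h2 : 0 ≤ ∑ j : Fin 4, ‖fderiv ℝ v x (EuclideanSpace.single j (1 : ℝ))‖ ^ 2 := by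
    positivity
  linarith

lemma hasFDerivAt_norm_of_ne_zero {z : Sp} (hz : z ≠ 0) :
    HasFDerivAt (fun y : Sp => ‖y‖) (‖z‖⁻¹ • innerSL ℝ z) z := by
  have h := ((hasStrictFDerivAt_norm_sq z).hasFDerivAt).sqrt (by positivity)
  have h2 : (fun y : Sp => √(‖y‖ ^ 2)) = fun y => ‖y‖ := by ext y; simp
  rw [h2] at h
  convert! h using 1
  rw [Real.sqrt_sq (norm_nonneg z), two_nsmul, ← two_smul ℝ, smul_smul]
  congr 1
  field_simp

lemma hasFDerivAt_shift {z : Sp} (hz : z ≠ 0) (c : ℝ) :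
    HasFDerivAt (fun y : Sp => (1 + c * ‖y‖⁻¹) • y)
      ((1 + c * ‖z‖⁻¹) • ContinuousLinearMap.id ℝ Sp +
        ((c * (-(‖z‖ ^ 2)⁻¹)) • (‖z‖⁻¹ • innerSL ℝ z)).smulRight z) z := by
  have h1 := (((hasDerivAt_inv (norm_ne_zero_iff.2 hz)).comp_hasFDerivAt z
    (hasFDerivAt_norm_of_ne_zero hz)).const_mul c).const_add 1
  have h2 := h1.smul (hasFDerivAt_id z)
  convert! h2 using 1
  simp [smul_smul, mul_assoc]

/-- Radial shift of a function, localized to a fixed annulus. -/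
def radialShift (f : ℝ → ℝ) (c : ℝ) (v : Sp → ℂ) (z : Sp) : ℂ :=
  f ‖z‖ • v ((1 + c * ‖z‖⁻¹) • z)

lemma norm_fderiv_radialShift_le {f : ℝ → ℝ} (hf : ContDiff ℝ 1 f) {M : ℝ}
    (h0 : ∀ s, |f s| ≤ 1) (hM : ∀ s, |deriv f s| ≤ M) {c : ℝ} (hc : 0 ≤ c) {v : Sp → ℂ}
    (hv : ContDiff ℝ 1 v) {z : Sp} (hz : 1 / 2 ≤ ‖z‖) :
    ‖fderiv ℝ (radialShift f c v) z‖ ≤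
      (36 + M) * √(angEnergy v ((1 + c * ‖z‖⁻¹) • z)) := by
  have hz0 : z ≠ 0 := norm_pos_iff.1 (by linarith)
  have hn : 0 < ‖z‖ := by linarith
  have hM0 : 0 ≤ M := (abs_nonneg _).trans (hM 0)
  set x : Sp := (1 + c * ‖z‖⁻¹) • z with hx
  have h1 : HasFDerivAt (fun y : Sp => f ‖y‖) (deriv f ‖z‖ • (‖z‖⁻¹ • innerSL ℝ z)) z :=
    (hf.differentiable (by norm_num) ‖z‖).hasDerivAt.comp_hasFDerivAt z
      (hasFDerivAt_norm_of_ne_zero hz0)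
  have h2 : HasFDerivAt (fun y : Sp => v ((1 + c * ‖y‖⁻¹) • y)) _ z :=
    (hv.differentiable (by norm_num) x).hasFDerivAt.comp z (hasFDerivAt_shift hz0 c)
  have h3 : HasFDerivAt (radialShift f c v) _ z := h1.smul h2
  set e := √(angEnergy v x) with he
  have he0 : 0 ≤ e := Real.sqrt_nonneg _
  rw [h3.fderiv]
  refine ContinuousLinearMap.opNorm_le_bound _ (by positivity) fun h => ?_
  have hxn : ‖x‖ = ‖z‖ + c := by
    rw [hx, norm_smul, Real.norm_of_nonneg (by positivity)]
    field_simp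
  have hx0 : 0 < ‖x‖ := by linarith
  have hzx : z = (‖z‖ / ‖x‖) • x := by
    rw [hx, smul_smul, ← hx, hxn]
    have : ‖z‖ / (‖z‖ + c) * (1 + c * ‖z‖⁻¹) = 1 := by field_simp
    rw [this, one_smul]
  have hD : ((1 + c * ‖z‖⁻¹) • ContinuousLinearMap.id ℝ Sp +
        ((c * (-(‖z‖ ^ 2)⁻¹)) • (‖z‖⁻¹ • innerSL ℝ z)).smulRight z) h =
      h + (c / (‖z‖ * ‖x‖ ^ 2)) • (‖x‖ ^ 2 • h - ⟪x, h⟫ • x) := by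
    have hin : ⟪z, h⟫ = ‖z‖ / ‖x‖ * ⟪x, h⟫ := by
      conv_lhs => rw [hzx]
      rw [real_inner_smul_left]
    simp only [add_apply, smul_apply,
      ContinuousLinearMap.id_apply, ContinuousLinearMap.smulRight_apply, innerSL_apply_apply,
      smul_eq_mul]
    have key : ∀ a : ℝ, a • z = (a * (‖z‖ / ‖x‖)) • x := fun a => by
      conv_lhs => rw [hzx]
      rw [smul_smul]
    rw [hin, key]
    clear_value x
    match_scalars
    · field_simp
    · field_simp
      try ring
  have hA : ‖fderiv ℝ v x (h + (c / (‖z‖ * ‖x‖ ^ 2)) • (‖x‖ ^ 2 • h - ⟪x, h⟫ • x))‖ ≤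
      36 * e * ‖h‖ := by
    rw [map_add, map_smul]
    refine (norm_add_le _ _).trans ?_
    rw [norm_smul, Real.norm_of_nonneg (by positivity)]
    have b1 := norm_fderiv_apply_sq_le v x h
    have b2 := norm_fderiv_tangential_le v x h
    have b3 : c / (‖z‖ * ‖x‖ ^ 2) * ‖x‖ ≤ 2 := by
      rw [hxn]
      have : c / (‖z‖ * (‖z‖ + c) ^ 2) * (‖z‖ + c) = (c / (‖z‖ + c)) / ‖z‖ := by
        field_simp
      rw [this, div_le_iff₀ hn]
      have : c / (‖z‖ + c) ≤ 1 := div_le_one_of_le₀ (by linarith) (by linarith)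
      linarith
    calc _ ≤ ‖h‖ * (4 * e) + c / (‖z‖ * ‖x‖ ^ 2) * (‖x‖ * ‖h‖ * (16 * e)) := by
          gcongr
      _ = ‖h‖ * (4 * e) + (c / (‖z‖ * ‖x‖ ^ 2) * ‖x‖) * (‖h‖ * (16 * e)) := by ring
      _ ≤ ‖h‖ * (4 * e) + 2 * (‖h‖ * (16 * e)) := by gcongr
      _ = _ := by ring
  have hB : ‖(deriv f ‖z‖ • (‖z‖⁻¹ • innerSL ℝ z)) h‖ ≤ M * ‖h‖ := by
    simp only [smul_apply, innerSL_apply_apply, smul_eq_mul, norm_mul,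
      norm_inv, norm_norm]
    have := norm_inner_le_norm (𝕜 := ℝ) z h
    calc _ ≤ M * (‖z‖⁻¹ * (‖z‖ * ‖h‖)) := by
          gcongr
          exact hM _
      _ = _ := by field_simp
  have hfz : ‖f ‖z‖‖ ≤ 1 := h0 _
  have hvx : ‖v x‖ ≤ e := norm_le_sqrt_angEnergy v x
  calc _ = ‖f ‖z‖ • fderiv ℝ v x (h + (c / (‖z‖ * ‖x‖ ^ 2)) • (‖x‖ ^ 2 • h - ⟪x, h⟫ • x)) +
          (deriv f ‖z‖ • (‖z‖⁻¹ • innerSL ℝ z)) h • v x‖ := by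
        rw [← hD]
        rfl
    _ ≤ 1 * (36 * e * ‖h‖) + (M * ‖h‖) * e := by
        refine (norm_add_le _ _).trans ?_
        exact add_le_add ((norm_smul_le _ _).trans (mul_le_mul hfz hA (norm_nonneg _) zero_le_one))
          ((norm_smul_le _ _).trans (mul_le_mul hB hvx (norm_nonneg _) (by positivity)))
    _ = _ := by ring

/-- The closed shell of radii between `a` and `b`. -/
def shell (a b : ℝ) : Set Sp := {x | a ≤ ‖x‖ ∧ ‖x‖ ≤ b}

lemma measurableSet_shell (a b : ℝ) : MeasurableSet (shell a b) := by
  refine MeasurableSet.inter (measurableSet_le measurable_const measurable_norm)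
    (measurableSet_le measurable_norm measurable_const)

lemma continuous_angEnergy {v : Sp → ℂ} (hv : ContDiff ℝ 1 v) : Continuous (angEnergy v) := by
  have h1 : Continuous v := hv.continuous
  have h2 : Continuous (fderiv ℝ v) := hv.continuous_fderiv (by norm_num)
  have h3 : ∀ j : Fin 4, Continuous fun x => fderiv ℝ v x (EuclideanSpace.single j (1 : ℝ)) :=
    fun j => h2.clm_apply continuous_const
  unfold angEnergy Omega
  have h4 : ∀ i : Fin 4, Continuous fun x : Sp => ((x i : ℝ) : ℂ) := fun i => by fun_prop
  fun_prop

lemma enorm_sq_le_of_norm_le {z : Sp →L[ℝ] ℂ} {A e : ℝ} (he : 0 ≤ e) (h : ‖z‖ ≤ A * √e) :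
    ‖z‖ₑ ^ 2 ≤ ENNReal.ofReal (A ^ 2) * ENNReal.ofReal e := by
  rw [← ENNReal.ofReal_mul (by positivity), ← ofReal_norm, ← ENNReal.ofReal_pow (norm_nonneg _)]
  refine ENNReal.ofReal_le_ofReal ?_
  calc ‖z‖ ^ 2 ≤ (A * √e) ^ 2 := by gcongr
    _ = _ := by rw [mul_pow, Real.sq_sqrt he]

lemma enorm_sq_clm_zero : ‖(0 : Sp →L[ℝ] ℂ)‖ₑ ^ 2 = 0 := by
  rw [← ofReal_norm, norm_zero]
  simp

lemma lintegral_shell_zero_le : ∃ C : ℝ≥0∞, C ≠ ∞ ∧ ∀ v : Sp → ℂ, ContDiff ℝ 1 v →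
    ∫⁻ x, (shell 0 1).indicator (fun x => ‖v x‖ₑ ^ 4) x ≤
      C * (∫⁻ x, (shell (-1) 2).indicator (fun x => ENNReal.ofReal (angEnergy v x)) x) ^ 2 := by
  obtain ⟨C, hC, hgns⟩ := lintegral_pow_four_le_fderiv
  let χ : ContDiffBump (0 : Sp) := ⟨1, 2, by norm_num, by norm_num⟩
  have hχ : ContDiff ℝ 1 χ := χ.contDiff
  obtain ⟨M, hM⟩ := (χ.hasCompactSupport.fderiv (𝕜 := ℝ)).exists_bound_of_continuous
    (hχ.continuous_fderiv (by norm_num))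
  have hM0 : 0 ≤ M := (norm_nonneg _).trans (hM 0)
  refine ⟨C * (ENNReal.ofReal ((4 + M) ^ 2)) ^ 2, by finiteness, fun v hv => ?_⟩
  have hw : ContDiff ℝ 1 fun x => χ x • v x := hχ.smul hv
  have hD : ∀ x, ‖fderiv ℝ (fun x => χ x • v x) x‖ₑ ^ 2 ≤ ENNReal.ofReal ((4 + M) ^ 2) *
      (shell (-1) 2).indicator (fun x => ENNReal.ofReal (angEnergy v x)) x := by
    intro x
    by_cases hx : ‖x‖ ≤ 2
    · have hmem : x ∈ shell (-1) 2 := ⟨by linarith [norm_nonneg x], hx⟩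
      rw [Set.indicator_of_mem hmem]
      refine enorm_sq_le_of_norm_le (angEnergy_nonneg v x) ?_
      rw [fderiv_fun_smul (hχ.differentiable (by norm_num) x) (hv.differentiable (by norm_num) x)]
      refine ContinuousLinearMap.opNorm_le_bound _ (by positivity) fun h => ?_
      have h1 := norm_fderiv_apply_sq_le v x h
      have h2 : ‖fderiv ℝ χ x h‖ ≤ M * ‖h‖ := (fderiv ℝ χ x).le_of_opNorm_le (hM x) h
      have h3 : ‖χ x‖ ≤ 1 := by
        rw [Real.norm_of_nonneg χ.nonneg]; exact χ.le_one
      calc _ = ‖χ x • fderiv ℝ v x h + fderiv ℝ χ x h • v x‖ := rfl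
        _ ≤ 1 * (‖h‖ * (4 * √(angEnergy v x))) + (M * ‖h‖) * √(angEnergy v x) :=
          (norm_add_le _ _).trans <| add_le_add
            ((norm_smul_le _ _).trans (mul_le_mul h3 h1 (norm_nonneg _) zero_le_one))
            ((norm_smul_le _ _).trans (mul_le_mul h2 (norm_le_sqrt_angEnergy v x)
              (norm_nonneg _) (by positivity)))
        _ = _ := by ring
    · have : (fun x => χ x • v x) =ᶠ[nhds x] fun _ => 0 := by
        have ho : IsOpen {y : Sp | 2 < ‖y‖} := isOpen_lt continuous_const continuous_norm
        filter_upwards [ho.mem_nhds (by simpa using hx : x ∈ {y : Sp | 2 < ‖y‖})] with y hy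
        have : χ y = 0 := χ.zero_of_le_dist (by
          rw [dist_zero_right]; exact le_of_lt hy)
        rw [this, zero_smul]
      rw [this.fderiv_eq, fderiv_fun_const, Pi.zero_apply, enorm_sq_clm_zero]
      exact zero_le
  calc _ ≤ ∫⁻ x, ‖χ x • v x‖ₑ ^ 4 := by
        refine lintegral_mono fun x => ?_
        refine Set.indicator_le' (g := fun x => ‖χ x • v x‖ₑ ^ 4) (fun x hx => ?_)
          (fun _ _ => zero_le) x
        rw [χ.one_of_mem_closedBall (by simpa using hx.2), one_smul]
    _ ≤ C * (∫⁻ x, ‖fderiv ℝ (fun x => χ x • v x) x‖ₑ ^ 2) ^ 2 :=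
        hgns _ hw χ.hasCompactSupport.smul_right
    _ ≤ C * (∫⁻ x, ENNReal.ofReal ((4 + M) ^ 2) *
          (shell (-1) 2).indicator (fun x => ENNReal.ofReal (angEnergy v x)) x) ^ 2 := by
        gcongr with x
        exact hD x
    _ = _ := by
        rw [lintegral_const_mul' _ _ (by finiteness)]
        ring

lemma contDiff_radialShift {f : ℝ → ℝ} (hf : ContDiff ℝ 1 f) (h0 : ∀ s ≤ 1 / 2, f s = 0) (c : ℝ)
    {v : Sp → ℂ} (hv : ContDiff ℝ 1 v) : ContDiff ℝ 1 (radialShift f c v) := by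
  rw [contDiff_iff_contDiffAt]
  intro z
  by_cases hz : z = 0
  · subst hz
    refine (contDiffAt_const (c := (0 : ℂ))).congr_of_eventuallyEq ?_
    filter_upwards [Metric.ball_mem_nhds (0 : Sp) (show (0 : ℝ) < 1 / 2 by norm_num)] with y hy
    rw [radialShift, h0 _ (by simpa using (mem_ball_zero_iff.1 hy).le), zero_smul]
  · have hn : ContDiffAt ℝ 1 (fun y : Sp => ‖y‖) z := contDiffAt_norm ℝ hz
    have hi : ContDiffAt ℝ 1 (fun y : Sp => ‖y‖⁻¹) z := hn.inv (norm_ne_zero_iff.2 hz)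
    exact (hf.contDiffAt.comp z hn).smul (hv.contDiffAt.comp z
      ((contDiffAt_const.add (contDiffAt_const.mul hi)).smul contDiffAt_id))

lemma fderiv_radialShift_eq_zero {f : ℝ → ℝ} (c : ℝ) (v : Sp → ℂ) {z : Sp} {U : Set ℝ}
    (hU : IsOpen U) (hf : ∀ s ∈ U, f s = 0) (hz : ‖z‖ ∈ U) :
    fderiv ℝ (radialShift f c v) z = 0 := by
  have : radialShift f c v =ᶠ[nhds z] fun _ => 0 := by
    filter_upwards [(hU.preimage continuous_norm).mem_nhds hz] with y hy
    rw [radialShift, hf _ hy, zero_smul]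
  rw [this.fderiv_eq]
  simp

lemma lintegral_shell_pos_le : ∃ C : ℝ≥0∞, C ≠ ∞ ∧ ∀ v : Sp → ℂ, ContDiff ℝ 1 v → ∀ k : ℝ, 1 ≤ k →
    ∫⁻ x, (shell k (k + 1)).indicator (fun x => ‖v x‖ₑ ^ 4) x ≤
      C * ENNReal.ofReal (((k + 1) ^ 3)⁻¹) * (∫⁻ x, (shell (k - 1) (k + 2)).indicator
        (fun x => ENNReal.ofReal (angEnergy v x)) x) ^ 2 := by
  obtain ⟨C, hC, hgns⟩ := lintegral_pow_four_le_fderiv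
  let f : ContDiffBump (3 / 2 : ℝ) := ⟨1 / 2, 1, by norm_num, by norm_num⟩
  have hf : ContDiff ℝ 1 f := f.contDiff
  obtain ⟨M, hM⟩ := f.hasCompactSupport.deriv.exists_bound_of_continuous
    (hf.continuous_deriv (by norm_num))
  have hM0 : 0 ≤ M := (norm_nonneg _).trans (hM 0)
  have hlo : ∀ s ≤ 1 / 2, f s = 0 := fun s hs => f.zero_of_le_dist (by
    rw [Real.dist_eq, abs_of_nonpos (by linarith)]; show (1 : ℝ) ≤ _; linarith)
  have hhi : ∀ s ≥ 5 / 2, f s = 0 := fun s hs => f.zero_of_le_dist (by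
    rw [Real.dist_eq, abs_of_nonneg (by linarith)]; show (1 : ℝ) ≤ _; linarith)
  have hone : ∀ s, 1 ≤ s → s ≤ 2 → f s = 1 := fun s h1 h2 => f.one_of_mem_closedBall (by
    rw [Metric.mem_closedBall, Real.dist_eq, abs_le]; constructor
    · show -(1 / 2 : ℝ) ≤ _; linarith
    · show _ ≤ (1 / 2 : ℝ); linarith)
  have habs : ∀ s, |f s| ≤ 1 := fun s => by rw [abs_of_nonneg f.nonneg]; exact f.le_one
  set A : ℝ := (36 + M) ^ 2 with hA
  refine ⟨C * ENNReal.ofReal (1000 * A) ^ 2, by finiteness, fun v hv k hk => ?_⟩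
  set c := k - 1 with hc
  have hc0 : 0 ≤ c := by linarith
  set w := radialShift f c v with hw
  have hwc : ContDiff ℝ 1 w := contDiff_radialShift hf hlo c hv
  have hws : HasCompactSupport w := by
    refine HasCompactSupport.intro (isCompact_closedBall (0 : Sp) (5 / 2)) fun x hx => ?_
    rw [hw, radialShift, hhi _ (by simp at hx; linarith), zero_smul]
  have hscale : ∀ (ω : Sp) (s : ℝ), ‖ω‖ = 1 → 0 < s →
      (1 + c * ‖s • ω‖⁻¹) • s • ω = (s + c) • ω := by
    intro ω s hω hs
    rw [norm_smul, hω, mul_one, Real.norm_of_nonneg hs.le, smul_smul]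
    congr 1
    field_simp
  have hme : Measurable fun x => ENNReal.ofReal (angEnergy v x) :=
    (continuous_angEnergy hv).measurable.ennreal_ofReal
  have hL : ∫⁻ x, (shell k (k + 1)).indicator (fun x => ‖v x‖ₑ ^ 4) x ≤
      ENNReal.ofReal ((k + 1) ^ 3) * ∫⁻ x, ‖w x‖ₑ ^ 4 := by
    refine lintegral_le_of_radial_shift (c := -c)
      ((hv.continuous.measurable.enorm.pow_const 4).indicator (measurableSet_shell _ _))
      (hwc.continuous.measurable.enorm.pow_const 4) (by finiteness) fun ω hω s hs hF => ?_
    have hmem : s • ω ∈ shell k (k + 1) := Set.mem_of_indicator_ne_zero hF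
    rw [Set.indicator_of_mem hmem]
    simp only [shell, Set.mem_ofPred_eq, norm_smul, hω, mul_one, Real.norm_of_nonneg hs.le] at hmem
    have hs1 : 1 ≤ s + -c := by linarith [hmem.1]
    have hs2 : s + -c ≤ 2 := by linarith [hmem.2]
    refine ⟨by linarith, ?_⟩
    have hwv : w ((s + -c) • ω) = v (s • ω) := by
      rw [hw, radialShift, hscale ω _ hω (by linarith), norm_smul, hω, mul_one,
        Real.norm_of_nonneg (by linarith), hone _ hs1 hs2, one_smul]
      congr 2
      ring
    rw [hwv, ← mul_assoc, ← ENNReal.ofReal_mul (by positivity)]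
    gcongr
    calc s ^ 3 ≤ (k + 1) ^ 3 * 1 := by rw [mul_one]; gcongr; exact hmem.2
      _ ≤ _ := by gcongr; exact one_le_pow₀ hs1
  have hR : ∫⁻ x, ‖fderiv ℝ w x‖ₑ ^ 2 ≤ ENNReal.ofReal (1000 * A * ((k + 1) ^ 3)⁻¹) *
      ∫⁻ x, (shell (k - 1) (k + 2)).indicator (fun x => ENNReal.ofReal (angEnergy v x)) x := by
    refine lintegral_le_of_radial_shift (c := c)
      ((hwc.continuous_fderiv (by norm_num)).measurable.enorm.pow_const 2)
      (hme.indicator (measurableSet_shell _ _)) (by finiteness) fun ω hω s hs hF => ?_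
    have hns : ‖s • ω‖ = s := by rw [norm_smul, hω, mul_one, Real.norm_of_nonneg hs.le]
    have hs1 : 1 / 2 ≤ s := by
      by_contra hcon
      refine hF ?_
      rw [hw, fderiv_radialShift_eq_zero c v isOpen_Iio (U := Set.Iio (1 / 2))
        (fun s hs => hlo s (le_of_lt hs)) (by rw [hns]; simpa using hcon), enorm_sq_clm_zero]
    have hs2 : s ≤ 5 / 2 := by
      by_contra hcon
      refine hF ?_
      rw [hw, fderiv_radialShift_eq_zero c v isOpen_Ioi (U := Set.Ioi (5 / 2))
        (fun s hs => hhi s (le_of_lt hs)) (by rw [hns]; simpa using hcon), enorm_sq_clm_zero]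
    refine ⟨by linarith, ?_⟩
    have hmem : (s + c) • ω ∈ shell (k - 1) (k + 2) := by
      simp only [shell, Set.mem_ofPred_eq, norm_smul, hω, mul_one]
      rw [Real.norm_of_nonneg (by linarith)]
      constructor <;> linarith
    rw [Set.indicator_of_mem hmem]
    have hb := norm_fderiv_radialShift_le hf habs (M := M) (fun s => hM s) hc0 hv
      (z := s • ω) (by rw [hns]; exact hs1)
    rw [hscale ω s hω hs] at hb
    have hb2 := enorm_sq_le_of_norm_le (angEnergy_nonneg v _) hb
    calc _ ≤ ENNReal.ofReal (s ^ 3) * (ENNReal.ofReal A * ENNReal.ofReal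
          (angEnergy v ((s + c) • ω))) := by gcongr
      _ = ENNReal.ofReal (A * s ^ 3) * ENNReal.ofReal (angEnergy v ((s + c) • ω)) := by
          rw [ENNReal.ofReal_mul (by positivity)]; ring
      _ ≤ ENNReal.ofReal (1000 * A * ((k + 1) ^ 3)⁻¹ * (s + c) ^ 3) *
          ENNReal.ofReal (angEnergy v ((s + c) • ω)) := by
          refine mul_le_mul' (ENNReal.ofReal_le_ofReal ?_) le_rfl
          have h1 : s ≤ 10 * (k + 1)⁻¹ * (s + c) := by
            rw [mul_assoc, ← div_eq_inv_mul, ← mul_div_assoc, le_div_iff₀ (by linarith)]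
            nlinarith
          calc A * s ^ 3 ≤ A * (10 * (k + 1)⁻¹ * (s + c)) ^ 3 := by gcongr
            _ = _ := by rw [← inv_pow]; ring
      _ = _ := by
          rw [ENNReal.ofReal_mul (by positivity), mul_assoc]
  calc _ ≤ ENNReal.ofReal ((k + 1) ^ 3) * ∫⁻ x, ‖w x‖ₑ ^ 4 := hL
    _ ≤ ENNReal.ofReal ((k + 1) ^ 3) * (C * (∫⁻ x, ‖fderiv ℝ w x‖ₑ ^ 2) ^ 2) := by
        gcongr; exact hgns w hwc hws
    _ ≤ ENNReal.ofReal ((k + 1) ^ 3) * (C * (ENNReal.ofReal (1000 * A * ((k + 1) ^ 3)⁻¹) *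
      ∫⁻ x, (shell (k - 1) (k + 2)).indicator
        (fun x => ENNReal.ofReal (angEnergy v x)) x) ^ 2) := by gcongr
    _ = _ := by
        have h1 : ENNReal.ofReal ((k + 1) ^ 3) * ENNReal.ofReal (((k + 1) ^ 3)⁻¹) = 1 := by
          rw [← ENNReal.ofReal_mul (by positivity), mul_inv_cancel₀ (by positivity),
            ENNReal.ofReal_one]
        rw [ENNReal.ofReal_mul (p := 1000 * A) (by positivity)]
        set N := ∫⁻ x, (shell (k - 1) (k + 2)).indicator
          (fun x => ENNReal.ofReal (angEnergy v x)) x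
        calc _ = (ENNReal.ofReal ((k + 1) ^ 3) * ENNReal.ofReal (((k + 1) ^ 3)⁻¹)) *
              (C * ENNReal.ofReal (1000 * A) ^ 2 * ENNReal.ofReal (((k + 1) ^ 3)⁻¹) * N ^ 2) := by
              ring
          _ = _ := by rw [h1, one_mul]

/-- Sobolev inequality on unit shells with gain from the angular derivatives. -/
lemma lintegral_shell_le : ∃ C : ℝ≥0∞, C ≠ ∞ ∧ ∀ v : Sp → ℂ, ContDiff ℝ 1 v → ∀ k : ℕ,
    ∫⁻ x, (shell k (k + 1)).indicator (fun x => ‖v x‖ₑ ^ 4) x ≤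
      C * ENNReal.ofReal ((((k : ℝ) + 1) ^ 3)⁻¹) * (∫⁻ x, (shell (k - 1) (k + 2)).indicator
        (fun x => ENNReal.ofReal (angEnergy v x)) x) ^ 2 := by
  obtain ⟨C0, hC0, h0⟩ := lintegral_shell_zero_le
  obtain ⟨C1, hC1, h1⟩ := lintegral_shell_pos_le
  refine ⟨max C0 C1, by simp [hC0, hC1], fun v hv k => ?_⟩
  rcases Nat.eq_zero_or_pos k with hk | hk
  · subst hk
    have := h0 v hv
    simp only [Nat.cast_zero, zero_add, one_pow, inv_one, ENNReal.ofReal_one, mul_one, zero_sub]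
    refine this.trans ?_
    gcongr
    exact le_max_left _ _
  · refine (h1 v hv k (by exact_mod_cast hk)).trans ?_
    gcongr
    exact le_max_right _ _

lemma lintegral_rpow_le_interp {α : Type*} [MeasurableSpace α] {μ : Measure α} {g : α → ℝ≥0∞}
    (hg : AEMeasurable g μ) {p₀ p₁ θ p : ℝ} (h₀ : 0 ≤ p₀) (h₁ : 0 ≤ p₁) (hθ0 : 0 ≤ θ)
    (hθ1 : θ ≤ 1) (hp : p = p₀ * θ + p₁ * (1 - θ)) :
    ∫⁻ x, g x ^ p ∂μ ≤ (∫⁻ x, g x ^ p₀ ∂μ) ^ θ * (∫⁻ x, g x ^ p₁ ∂μ) ^ (1 - θ) := by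
  have hθ : 0 ≤ 1 - θ := by linarith
  calc _ = ∫⁻ x, (g x ^ p₀) ^ θ * (g x ^ p₁) ^ (1 - θ) ∂μ := by
        refine lintegral_congr fun x => ?_
        rw [hp, ENNReal.rpow_add_of_nonneg _ _ (by positivity) (by positivity), ENNReal.rpow_mul,
          ENNReal.rpow_mul]
    _ ≤ _ := ENNReal.lintegral_mul_norm_pow_le (hg.pow_const _) (hg.pow_const _) hθ0 hθ
        (by ring)

lemma ENNReal.rpow_tsum_le_tsum_rpow {ι : Type*} (a : ι → ℝ≥0∞) {p : ℝ} (hp0 : 0 < p)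
    (hp1 : p ≤ 1) : (∑' i, a i) ^ p ≤ ∑' i, a i ^ p := by
  have hfin : ∀ s : Finset ι, (∑ i ∈ s, a i) ^ p ≤ ∑ i ∈ s, a i ^ p := by
    intro s
    classical
    induction s using Finset.induction_on with
    | empty => simp [hp0]
    | insert i s hi ih =>
      rw [Finset.sum_insert hi, Finset.sum_insert hi]
      exact (ENNReal.rpow_add_le_add_rpow _ _ hp0.le hp1).trans (by gcongr)
  have ht := (ENNReal.continuous_rpow_const (y := p)).tendsto _ |>.comp
    (ENNReal.summable (f := a)).hasSum
  exact le_of_tendsto' ht fun s => (hfin s).trans (ENNReal.sum_le_tsum s)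

lemma tsum_shell_le {a : ℝ} (ha : 0 ≤ a) (x : Sp) :
    ∑' k : ℕ, ENNReal.ofReal (((k : ℝ) + 1) ^ (-a)) *
      (shell ((k : ℝ) - 1) (k + 2)).indicator 1 x ≤
      ENNReal.ofReal (4 * 3 ^ a) * ENNReal.ofReal ((1 + ‖x‖) ^ (-a)) := by
  set m := ⌊‖x‖⌋₊ with hm
  have hm1 : (m : ℝ) ≤ ‖x‖ := Nat.floor_le (norm_nonneg x)
  have hm2 : ‖x‖ < m + 1 := Nat.lt_floor_add_one _
  rw [tsum_eq_sum (s := Finset.Icc (m - 2) (m + 1)) fun k hk => ?_]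
  · have hcard : (Finset.Icc (m - 2) (m + 1)).card ≤ 4 := by
      rw [Nat.card_Icc]; omega
    refine (Finset.sum_le_card_nsmul _ _
      (ENNReal.ofReal (3 ^ a) * ENNReal.ofReal ((1 + ‖x‖) ^ (-a))) fun k hk => ?_).trans ?_
    · by_cases hx : x ∈ shell ((k : ℝ) - 1) (k + 2)
      · rw [Set.indicator_of_mem hx, Pi.one_apply, mul_one, ← ENNReal.ofReal_mul (by positivity)]
        refine ENNReal.ofReal_le_ofReal ?_
        have h0 : (0 : ℝ) ≤ k := by positivity
        have h1 : (1 + ‖x‖) / 3 ≤ (k : ℝ) + 1 := by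
          have := hx.2
          linarith
        calc ((k : ℝ) + 1) ^ (-a) ≤ ((1 + ‖x‖) / 3) ^ (-a) :=
              Real.rpow_le_rpow_of_nonpos (by positivity) h1 (by linarith)
          _ = _ := by
              rw [Real.div_rpow (by positivity) (by norm_num), Real.rpow_neg (by norm_num : (0:ℝ) ≤ 3),
                div_inv_eq_mul, mul_comm]
      · rw [Set.indicator_of_notMem hx, mul_zero]
        exact zero_le
    · rw [nsmul_eq_mul, ENNReal.ofReal_mul (p := 4) (by norm_num), mul_assoc]
      gcongr
      rw [ENNReal.ofReal_ofNat]
      exact_mod_cast hcard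
  · rw [Set.indicator_of_notMem, mul_zero]
    intro hx
    refine hk (Finset.mem_Icc.2 ⟨?_, ?_⟩)
    · have : (m : ℝ) < k + 3 := by linarith [hx.2]
      have : m < k + 3 := by exact_mod_cast this
      omega
    · have : (k : ℝ) < m + 2 := by linarith [hx.1]
      have : k < m + 2 := by exact_mod_cast this
      omega

/-- Weighted Sobolev inequality with angular derivatives. -/
lemma lintegral_rpow_le_weight {r : ℝ} (hr3 : 3 < r) (hr4 : r ≤ 4) : ∃ C : ℝ≥0∞, C ≠ ∞ ∧
    ∀ v : Sp → ℂ, ContDiff ℝ 1 v → (∫⁻ x, ‖v x‖ₑ ^ r) ^ (2 / r) ≤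
      C * ∫⁻ x, ENNReal.ofReal ((1 + ‖x‖) ^ (-(3 - 6 / r))) *
        ENNReal.ofReal (angEnergy v x) := by
  obtain ⟨C, hC, hE⟩ := lintegral_shell_le
  have hr0 : 0 < r := by linarith
  set a := 3 - 6 / r with ha
  have ha0 : 0 ≤ a := by
    have : 6 / r ≤ 3 := by rw [div_le_iff₀ hr0]; linarith
    linarith
  set α := r / 2 - 1 with hα
  have hα0 : 0 ≤ α := by linarith
  have hα1 : α ≤ 1 := by linarith
  have hCα : (C ^ α) ^ (2 / r) ≠ ∞ :=
    ENNReal.rpow_ne_top_of_nonneg (by positivity) (ENNReal.rpow_ne_top_of_nonneg hα0 hC)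
  refine ⟨(C ^ α) ^ (2 / r) * ENNReal.ofReal (4 * 3 ^ a), by finiteness, fun v hv => ?_⟩
  have hmv : Measurable fun x => ‖v x‖ₑ := hv.continuous.measurable.enorm
  have hme : Measurable fun x => ENNReal.ofReal (angEnergy v x) :=
    (continuous_angEnergy hv).measurable.ennreal_ofReal
  set N : ℕ → ℝ≥0∞ := fun k => ∫⁻ x, (shell ((k : ℝ) - 1) (k + 2)).indicator
    (fun x => ENNReal.ofReal (angEnergy v x)) x with hN
  have hcover : (⋃ k : ℕ, shell (k : ℝ) (k + 1)) = Set.univ := by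
    refine Set.eq_univ_of_forall fun x => Set.mem_iUnion.2 ⟨⌊‖x‖⌋₊, ?_, ?_⟩
    · exact Nat.floor_le (norm_nonneg x)
    · exact (Nat.lt_floor_add_one _).le
  have hshell : ∀ k : ℕ, (∫⁻ x in shell (k : ℝ) (k + 1), ‖v x‖ₑ ^ r) ^ (2 / r) ≤
      (C ^ α) ^ (2 / r) * (ENNReal.ofReal (((k : ℝ) + 1) ^ (-a)) * N k) := by
    intro k
    have hk : (0 : ℝ) < (k : ℝ) + 1 := by positivity
    have h4 : ∫⁻ x in shell (k : ℝ) (k + 1), ‖v x‖ₑ ^ (4 : ℝ) ≤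
        C * ENNReal.ofReal ((((k : ℝ) + 1) ^ 3)⁻¹) * N k ^ 2 := by
      rw [← lintegral_indicator (measurableSet_shell _ _)]
      have := hE v hv k
      simpa only [ENNReal.rpow_ofNat] using this
    have h2 : ∫⁻ x in shell (k : ℝ) (k + 1), ‖v x‖ₑ ^ (2 : ℝ) ≤ N k := by
      rw [← lintegral_indicator (measurableSet_shell _ _)]
      refine lintegral_mono fun x => ?_
      refine Set.indicator_le_indicator' (fun hx => ?_) |>.trans
        (Set.indicator_le_indicator_of_subset (fun y hy => ?_) (fun _ => zero_le) x)
      · rw [ENNReal.rpow_ofNat, ← ofReal_norm, ← ENNReal.ofReal_pow (norm_nonneg _)]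
        refine ENNReal.ofReal_le_ofReal ?_
        have := norm_le_sqrt_angEnergy v x
        exact (Real.le_sqrt (norm_nonneg _) (angEnergy_nonneg v x)).1 this
      · exact ⟨by linarith [hy.1], by linarith [hy.2]⟩
    have h3 := lintegral_rpow_le_interp (μ := volume.restrict (shell (k : ℝ) (k + 1)))
      hmv.aemeasurable (p₀ := 4) (p₁ := 2) (p := r) (by norm_num) (by norm_num) hα0 hα1
      (by rw [hα]; ring)
    calc _ ≤ ((C * ENNReal.ofReal ((((k : ℝ) + 1) ^ 3)⁻¹) * N k ^ 2) ^ α *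
          N k ^ (1 - α)) ^ (2 / r) := by
          refine ENNReal.rpow_le_rpow (h3.trans ?_) (by positivity)
          gcongr
      _ = (C ^ α * ENNReal.ofReal ((((k : ℝ) + 1) ^ 3)⁻¹) ^ α * N k ^ (r / 2)) ^ (2 / r) := by
          rw [ENNReal.mul_rpow_of_nonneg _ _ hα0, ENNReal.mul_rpow_of_nonneg _ _ hα0, mul_assoc,
            ← ENNReal.rpow_ofNat, ← ENNReal.rpow_mul,
            ← ENNReal.rpow_add_of_nonneg _ _ (by positivity) (by linarith)]
          congr 3
          rw [hα]; ring
      _ = (C ^ α) ^ (2 / r) * (ENNReal.ofReal (((k : ℝ) + 1) ^ (-a)) * N k) := by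
          have e1 : (N k ^ (r / 2)) ^ (2 / r) = N k := by
            rw [← ENNReal.rpow_mul, show r / 2 * (2 / r) = 1 by field_simp, ENNReal.rpow_one]
          have e2 : (ENNReal.ofReal ((((k : ℝ) + 1) ^ 3)⁻¹) ^ α) ^ (2 / r) =
              ENNReal.ofReal (((k : ℝ) + 1) ^ (-a)) := by
            rw [← ENNReal.rpow_mul, ENNReal.ofReal_rpow_of_nonneg (by positivity) (by positivity),
              ← Real.rpow_natCast, ← Real.rpow_neg hk.le, ← Real.rpow_mul hk.le]
            congr 2
            rw [ha, hα]
            push_cast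
            field_simp
            ring
          rw [ENNReal.mul_rpow_of_nonneg _ _ (by positivity),
            ENNReal.mul_rpow_of_nonneg _ _ (by positivity), e1, e2, mul_assoc]
  calc (∫⁻ x, ‖v x‖ₑ ^ r) ^ (2 / r)
      ≤ (∑' k : ℕ, ∫⁻ x in shell (k : ℝ) (k + 1), ‖v x‖ₑ ^ r) ^ (2 / r) := by
        gcongr
        rw [← setLIntegral_univ, ← hcover]
        exact lintegral_iUnion_le _ _
    _ ≤ ∑' k : ℕ, (∫⁻ x in shell (k : ℝ) (k + 1), ‖v x‖ₑ ^ r) ^ (2 / r) :=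
        ENNReal.rpow_tsum_le_tsum_rpow _ (by positivity) (by rw [div_le_one hr0]; linarith)
    _ ≤ ∑' k : ℕ, (C ^ α) ^ (2 / r) * (ENNReal.ofReal (((k : ℝ) + 1) ^ (-a)) * N k) :=
        ENNReal.tsum_le_tsum hshell
    _ = (C ^ α) ^ (2 / r) * ∫⁻ x, (∑' k : ℕ, ENNReal.ofReal (((k : ℝ) + 1) ^ (-a)) *
          (shell ((k : ℝ) - 1) (k + 2)).indicator 1 x) * ENNReal.ofReal (angEnergy v x) := by
        rw [ENNReal.tsum_mul_left]
        congr 1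
        simp_rw [← ENNReal.tsum_mul_right]
        have hmm : ∀ k : ℕ, AEMeasurable (fun x => ENNReal.ofReal (((k : ℝ) + 1) ^ (-a)) *
            (shell ((k : ℝ) - 1) (k + 2)).indicator 1 x * ENNReal.ofReal (angEnergy v x))
            volume := fun k => (((measurable_one.indicator
          (measurableSet_shell _ _)).const_mul _).mul hme).aemeasurable
        rw [lintegral_tsum hmm]
        congr 1
        ext k
        rw [hN, ← lintegral_const_mul' _ _ (by finiteness)]
        refine lintegral_congr fun x => ?_
        rw [mul_assoc]
        congr 1
        by_cases hx : x ∈ shell ((k : ℝ) - 1) (k + 2)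
        · simp [hx]
        · simp [hx]
    _ ≤ (C ^ α) ^ (2 / r) * ∫⁻ x, ENNReal.ofReal (4 * 3 ^ a) *
          (ENNReal.ofReal ((1 + ‖x‖) ^ (-a)) * ENNReal.ofReal (angEnergy v x)) := by
        refine mul_le_mul' le_rfl (lintegral_mono fun x => ?_)
        rw [← mul_assoc]
        exact mul_le_mul' (tsum_shell_le ha0 x) le_rfl
    _ = _ := by
        rw [lintegral_const_mul' _ _ (by finiteness), mul_assoc]

section

open scoped SchwartzMap LineDeriv ContDiff

lemma wave_eq_fourierInv (H : Sp → ℂ) (t : ℝ) (x : Sp) :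
    wave H t x = 𝓕⁻ (fun ξ : Sp => cexp (2 * Real.pi * I * ((t * ‖ξ‖ : ℝ) : ℂ)) * H ξ) x := by
  rw [Real.fourierInv_eq', wave]
  refine integral_congr_ae (Filter.Eventually.of_forall fun ξ => ?_)
  simp only [smul_eq_mul]
  rw [← mul_assoc, ← Complex.exp_add, real_inner_comm]
  congr 2
  push_cast
  ring

/-- The angular momentum operator on Schwartz functions. -/
def omegaSchwartz (i j : Fin 4) (g : 𝓢(Sp, ℂ)) : 𝓢(Sp, ℂ) :=
  ∂_{(EuclideanSpace.single j (1 : ℝ) : Sp)} (SchwartzMap.smulLeftCLM ℂ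
      (fun x : Sp => (inner ℝ x (EuclideanSpace.single i (1 : ℝ)) : ℝ)) g) -
    ∂_{(EuclideanSpace.single i (1 : ℝ) : Sp)} (SchwartzMap.smulLeftCLM ℂ
      (fun x : Sp => (inner ℝ x (EuclideanSpace.single j (1 : ℝ)) : ℝ)) g)

lemma hasTemperateGrowth_inner (m : Sp) :
    (fun x : Sp => (inner ℝ x m : ℝ)).HasTemperateGrowth :=
  ((innerSL ℝ).flip m).hasTemperateGrowth

lemma lineDeriv_mul_coord (g : 𝓢(Sp, ℂ)) (m e : Sp) (x : Sp) :
    (∂_{m} (SchwartzMap.smulLeftCLM ℂ (fun x : Sp => (inner ℝ x e : ℝ)) g)) x =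
      inner ℝ x e • fderiv ℝ g x m + inner ℝ m e • g x := by
  rw [SchwartzMap.lineDerivOp_apply_eq_fderiv,
    SchwartzMap.smulLeftCLM_apply (hasTemperateGrowth_inner e)]
  have h1 : HasFDerivAt (fun x : Sp => (inner ℝ x e : ℝ)) ((innerSL ℝ).flip e) x :=
    ((innerSL ℝ).flip e).hasFDerivAt
  have h2 := (g.differentiable x).hasFDerivAt
  have h3 : HasFDerivAt (fun x : Sp => (inner ℝ x e : ℝ) • g x) _ x := h1.smul h2
  rw [h3.fderiv]
  simp only [add_apply, smul_apply, ContinuousLinearMap.smulRight_apply]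
  rfl

lemma omegaSchwartz_coe (i j : Fin 4) (g : 𝓢(Sp, ℂ)) (x : Sp) :
    omegaSchwartz i j g x = Omega i j g x := by
  rw [omegaSchwartz, sub_apply, lineDeriv_mul_coord, lineDeriv_mul_coord, Omega]
  simp [EuclideanSpace.inner_single_right, PiLp.single_apply, eq_comm]

lemma fderiv_fourierInv (g : 𝓢(Sp, ℂ)) (m x : Sp) :
    fderiv ℝ (𝓕⁻ g : 𝓢(Sp, ℂ)) x m = 𝓕⁻ (fun ξ : Sp =>
      (2 * Real.pi * I) * ((inner ℝ ξ m : ℝ) * g ξ)) x := by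
  rw [← SchwartzMap.lineDerivOp_apply_eq_fderiv, SchwartzMap.lineDerivOp_fourierInv_eq,
    SchwartzMap.fourierInv_coe]
  refine congrArg (fun h : Sp → ℂ => 𝓕⁻ h x) (funext fun ξ => ?_)
  simp [SchwartzMap.smulLeftCLM_apply (hasTemperateGrowth_inner m)]

lemma omega_fourierInv (i j : Fin 4) (g : 𝓢(Sp, ℂ)) (x : Sp) :
    Omega i j (𝓕⁻ g : 𝓢(Sp, ℂ)) x = 𝓕⁻ (omegaSchwartz i j g) x := by
  have key : ∀ i j : Fin 4, (x i : ℂ) * fderiv ℝ (𝓕⁻ g : 𝓢(Sp, ℂ)) x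
      (EuclideanSpace.single j (1 : ℝ)) =
      - 𝓕⁻ (∂_{(EuclideanSpace.single i (1 : ℝ) : Sp)} (SchwartzMap.smulLeftCLM ℂ
      (fun x : Sp => (inner ℝ x (EuclideanSpace.single j (1 : ℝ)) : ℝ)) g)) x := by
    intro i j
    rw [← SchwartzMap.lineDerivOp_apply_eq_fderiv, SchwartzMap.lineDerivOp_fourierInv_eq,
      SchwartzMap.fourierInv_lineDerivOp_eq, FourierTransform.fourierInv_smul]
    simp only [smul_apply, neg_apply, neg_smul, neg_neg,
      SchwartzMap.smulLeftCLM_apply_apply (hasTemperateGrowth_inner _)]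
    simp [EuclideanSpace.inner_single_right]
    ring
  rw [Omega, key, key, omegaSchwartz, sub_eq_add_neg (∂_{_} _), FourierTransform.fourierInv_add,
    FourierTransform.fourierInv_neg, add_apply, neg_apply]
  ring

lemma lintegral_fourierInv_sq (g : 𝓢(Sp, ℂ)) :
    ∫⁻ x, ‖(𝓕⁻ g : 𝓢(Sp, ℂ)) x‖ₑ ^ 2 = ∫⁻ ξ, ‖g ξ‖ₑ ^ 2 := by
  have h := SchwartzMap.integral_norm_sq_fourier (𝓕⁻ g : 𝓢(Sp, ℂ))
  rw [FourierTransform.fourier_fourierInv_eq] at h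
  have hconv : ∀ k : 𝓢(Sp, ℂ), ∫⁻ x, ‖k x‖ₑ ^ 2 = ENNReal.ofReal (∫ x, ‖k x‖ ^ 2) := by
    intro k
    rw [ofReal_integral_eq_lintegral_ofReal (μ := volume) ((k.memLp 2).integrable_norm_pow (by norm_num))
      (Filter.Eventually.of_forall fun x => by positivity)]
    refine lintegral_congr fun x => ?_
    rw [← ofReal_norm, ENNReal.ofReal_pow (norm_nonneg _)]
  rw [hconv, hconv, h]

lemma isClosed_unitAnnulus : IsClosed unitAnnulus :=
  (isClosed_le continuous_const continuous_norm).inter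
    (isClosed_le continuous_norm continuous_const)

/-- The time-evolved Fourier data. -/
def phaseSchwartz (F : 𝓢(Sp, ℂ)) (hF : ∀ ξ, ξ ∉ unitAnnulus → F ξ = 0) (t : ℝ) : 𝓢(Sp, ℂ) :=
  HasCompactSupport.toSchwartzMap
    (f := fun ξ : Sp => cexp (2 * Real.pi * I * ((t * ‖ξ‖ : ℝ) : ℂ)) * F ξ)
    (HasCompactSupport.intro (isCompact_closedBall (0 : Sp) 2) fun ξ hξ => by
      rw [hF ξ fun h => hξ (by simpa using h.2), mul_zero])
    (contDiff_iff_contDiffAt.2 fun ξ => by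
      by_cases hξ : ξ = 0
      · refine (contDiffAt_const (c := (0 : ℂ))).congr_of_eventuallyEq ?_
        have : ξ ∈ unitAnnulusᶜ := fun h => by
          have := h.1
          rw [hξ, norm_zero] at this
          linarith
        filter_upwards [isClosed_unitAnnulus.isOpen_compl.mem_nhds this] with y hy
        rw [hF y hy, mul_zero]
      · have hn : ContDiffAt ℝ ∞ (fun y : Sp => t * ‖y‖) ξ :=
          contDiffAt_const.mul (contDiffAt_norm ℝ hξ)
        have h2 : ContDiffAt ℝ ∞ (fun y : Sp => ((t * ‖y‖ : ℝ) : ℂ)) ξ :=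
          Complex.ofRealCLM.contDiff.contDiffAt.comp ξ hn
        exact (contDiffAt_const.mul h2).cexp.mul (F.smooth ⊤).contDiffAt)

lemma phaseSchwartz_apply (F : 𝓢(Sp, ℂ)) (hF : ∀ ξ, ξ ∉ unitAnnulus → F ξ = 0) (t : ℝ) (ξ : Sp) :
    phaseSchwartz F hF t ξ = cexp (2 * Real.pi * I * ((t * ‖ξ‖ : ℝ) : ℂ)) * F ξ := rfl

lemma wave_eq_phaseSchwartz (F : 𝓢(Sp, ℂ)) (hF : ∀ ξ, ξ ∉ unitAnnulus → F ξ = 0) (t : ℝ) :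
    wave F t = (𝓕⁻ (phaseSchwartz F hF t) : 𝓢(Sp, ℂ)) := by
  ext x
  rw [wave_eq_fourierInv, SchwartzMap.fourierInv_coe]
  rfl

lemma omega_phaseSchwartz (F : 𝓢(Sp, ℂ)) (hF : ∀ ξ, ξ ∉ unitAnnulus → F ξ = 0) (t : ℝ)
    (i j : Fin 4) (ξ : Sp) :
    Omega i j (phaseSchwartz F hF t) ξ =
      cexp (2 * Real.pi * I * ((t * ‖ξ‖ : ℝ) : ℂ)) * Omega i j F ξ := by
  by_cases hξ : ξ = 0
  · subst hξ
    simp [Omega]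
  have h1 : HasFDerivAt (fun y : Sp => ((t * ‖y‖ : ℝ) : ℂ)) _ ξ :=
    Complex.ofRealCLM.hasFDerivAt.comp ξ ((hasFDerivAt_norm_of_ne_zero hξ).const_mul t)
  have h2 := ((h1.const_mul (2 * Real.pi * I)).cexp).mul (F.differentiable ξ).hasFDerivAt
  have h3 : HasFDerivAt (phaseSchwartz F hF t) _ ξ := h2
  rw [Omega, Omega, h3.fderiv]
  simp [EuclideanSpace.inner_single_right]
  ring

lemma wave_omega (F : 𝓢(Sp, ℂ)) (hF : ∀ ξ, ξ ∉ unitAnnulus → F ξ = 0) (t : ℝ) (i j : Fin 4)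
    (x : Sp) : Omega i j (wave F t) x = wave (Omega i j F) t x := by
  rw [wave_eq_phaseSchwartz F hF, omega_fourierInv, wave_eq_fourierInv, SchwartzMap.fourierInv_coe]
  refine congrArg (fun h : Sp → ℂ => 𝓕⁻ h x) (funext fun ξ => ?_)
  rw [omegaSchwartz_coe, omega_phaseSchwartz]

lemma wave_fderiv (F : 𝓢(Sp, ℂ)) (hF : ∀ ξ, ξ ∉ unitAnnulus → F ξ = 0) (t : ℝ) (m x : Sp) :
    fderiv ℝ (wave F t) x m =
      wave (fun ξ => (2 * Real.pi * I) * ((inner ℝ ξ m : ℝ) * F ξ)) t x := by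
  rw [wave_eq_phaseSchwartz F hF, fderiv_fourierInv, wave_eq_fourierInv]
  refine congrArg (fun h : Sp → ℂ => 𝓕⁻ h x) (funext fun ξ => ?_)
  rw [phaseSchwartz_apply]
  ring

lemma contDiff_wave (F : 𝓢(Sp, ℂ)) (hF : ∀ ξ, ξ ∉ unitAnnulus → F ξ = 0) (t : ℝ) :
    ContDiff ℝ 1 (wave F t) := by
  rw [wave_eq_phaseSchwartz F hF]
  exact SchwartzMap.smooth _ 1

lemma lintegral_wave_sq (F : 𝓢(Sp, ℂ)) (hF : ∀ ξ, ξ ∉ unitAnnulus → F ξ = 0) (t : ℝ) :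
    ∫⁻ x, ‖wave F t x‖ₑ ^ 2 = ∫⁻ ξ, ‖F ξ‖ₑ ^ 2 := by
  rw [wave_eq_phaseSchwartz F hF, lintegral_fourierInv_sq]
  refine lintegral_congr fun ξ => ?_
  rw [phaseSchwartz_apply, enorm_mul]
  have : ‖cexp (2 * Real.pi * I * ((t * ‖ξ‖ : ℝ) : ℂ))‖ₑ = 1 := by
    rw [← ofReal_norm, show 2 * Real.pi * I * ((t * ‖ξ‖ : ℝ) : ℂ) =
      ((2 * Real.pi * (t * ‖ξ‖) : ℝ) : ℂ) * I by push_cast; ring, Complex.norm_exp_ofReal_mul_I]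
    simp
  rw [this, one_mul]

end

section

open scoped SchwartzMap

/-- The squared size of a function together with its angular derivatives. -/
def angularNormSq (g : Sp → ℂ) : ℝ≥0∞ :=
  (∫⁻ x, ‖g x‖ₑ ^ 2) + ∑ i : Fin 4, ∑ j : Fin 4, ∫⁻ x, ‖Omega i j g x‖ₑ ^ 2

lemma ofReal_norm_sq (z : ℂ) : ENNReal.ofReal (‖z‖ ^ 2) = ‖z‖ₑ ^ 2 := by
  rw [← ofReal_norm, ENNReal.ofReal_pow (norm_nonneg _)]

lemma ofReal_angEnergy (v : Sp → ℂ) (x : Sp) : ENNReal.ofReal (angEnergy v x) =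
    ‖v x‖ₑ ^ 2 + ∑ j : Fin 4, ‖fderiv ℝ v x (EuclideanSpace.single j (1 : ℝ))‖ₑ ^ 2 +
      ∑ i : Fin 4, ∑ j : Fin 4, ‖Omega i j v x‖ₑ ^ 2 := by
  rw [angEnergy, ENNReal.ofReal_add (by positivity) (by positivity),
    ENNReal.ofReal_add (by positivity) (by positivity), ofReal_norm_sq,
    ENNReal.ofReal_sum_of_nonneg (fun i _ => by positivity),
    ENNReal.ofReal_sum_of_nonneg (fun i _ => by positivity)]
  simp_rw [ENNReal.ofReal_sum_of_nonneg (fun i _ => sq_nonneg _), ofReal_norm_sq]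

lemma Omega_eq_zero_of_notMem {F : Sp → ℂ} (hF : ∀ ξ, ξ ∉ unitAnnulus → F ξ = 0) (i j : Fin 4)
    (ξ : Sp) (hξ : ξ ∉ unitAnnulus) : Omega i j F ξ = 0 := by
  have : F =ᶠ[nhds ξ] fun _ => 0 := by
    filter_upwards [isClosed_unitAnnulus.isOpen_compl.mem_nhds hξ] with y hy using hF y hy
  rw [Omega, this.fderiv_eq]
  simp

set_option maxHeartbeats 1600000 in
lemma lintegral_weight_angEnergy_wave_le {a : ℝ} (ha : 1 < a) : ∃ C : ℝ≥0∞, C ≠ ∞ ∧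
    ∀ F : 𝓢(Sp, ℂ), (∀ ξ, ξ ∉ unitAnnulus → F ξ = 0) →
    ∫⁻ t : ℝ, (∫⁻ x, ENNReal.ofReal ((1 + ‖x‖) ^ (-a)) *
      ENNReal.ofReal (angEnergy (wave F t) x)) ≤ C * angularNormSq F := by
  obtain ⟨C, hC, h⟩ := lintegral_weight_wave_le ha
  set K : ℝ≥0∞ := ENNReal.ofReal (4 * Real.pi) ^ 2 with hK
  have hKt : K ≠ ∞ := by finiteness
  refine ⟨C * (1 + 4 * K), by finiteness, fun F hF => ?_⟩
  set D : Fin 4 → Sp → ℂ := fun j ξ =>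
    (2 * Real.pi * I) * ((inner ℝ ξ (EuclideanSpace.single j (1 : ℝ)) : ℝ) * F ξ) with hD
  have hFm : Measurable F := F.continuous.measurable
  have hDb : ∀ j ξ, ‖D j ξ‖ ≤ 4 * Real.pi * ‖F ξ‖ := by
    intro j ξ
    by_cases hξ : ξ ∈ unitAnnulus
    · have h1 : |inner ℝ ξ (EuclideanSpace.single j (1 : ℝ))| ≤ 2 := by
        refine (abs_real_inner_le_norm _ _).trans ?_
        simpa using hξ.2
      simp only [hD, norm_mul, Complex.norm_real, Complex.norm_I, Real.norm_eq_abs,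
        abs_of_pos Real.pi_pos, Complex.norm_ofNat, mul_one]
      have := mul_le_mul_of_nonneg_right h1 (norm_nonneg (F ξ))
      nlinarith [Real.pi_pos]
    · simp [hD, hF ξ hξ]
  have hDm : ∀ j, Measurable (D j) := fun j => by
    have : Continuous (D j) := by
      have := F.continuous
      fun_prop
    exact this.measurable
  have hDi : ∀ j, Integrable (D j) := fun j =>
    (F.integrable.norm.const_mul (4 * Real.pi)).mono' (hDm j).aestronglyMeasurable
      (Filter.Eventually.of_forall (hDb j))
  have hDsq : ∀ j, ∫⁻ ξ, ‖D j ξ‖ₑ ^ 2 ≤ K * ∫⁻ ξ, ‖F ξ‖ₑ ^ 2 := by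
    intro j
    rw [← lintegral_const_mul' _ _ hKt]
    refine lintegral_mono fun ξ => ?_
    rw [hK, ← mul_pow, ← ofReal_norm, ← ofReal_norm, ← ENNReal.ofReal_mul (by positivity)]
    gcongr
    exact hDb j ξ
  have hOc : ∀ i j, Omega i j F = omegaSchwartz i j F := fun i j =>
    funext fun ξ => (omegaSchwartz_coe i j F ξ).symm
  have hOm : ∀ i j, Measurable (Omega i j F) := fun i j => by
    rw [hOc]; exact (omegaSchwartz i j F).continuous.measurable
  have hOi : ∀ i j, Integrable (Omega i j F) := fun i j => by
    rw [hOc]; exact (omegaSchwartz i j F).integrable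
  have hwm : Measurable fun p : ℝ × Sp => ENNReal.ofReal ((1 + ‖p.2‖) ^ (-a)) := by fun_prop
  have hm : ∀ H : Sp → ℂ, Measurable H → Measurable fun p : ℝ × Sp =>
      ENNReal.ofReal ((1 + ‖p.2‖) ^ (-a)) * ‖wave H p.1 p.2‖ₑ ^ 2 := fun H hH =>
    hwm.mul ((measurable_wave hH).enorm.pow_const 2)
  have hexp : ∀ (t : ℝ) (x : Sp), ENNReal.ofReal ((1 + ‖x‖) ^ (-a)) *
      ENNReal.ofReal (angEnergy (wave F t) x) =
      ENNReal.ofReal ((1 + ‖x‖) ^ (-a)) * ‖wave F t x‖ₑ ^ 2 +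
      ∑ j, ENNReal.ofReal ((1 + ‖x‖) ^ (-a)) * ‖wave (D j) t x‖ₑ ^ 2 +
      ∑ i, ∑ j, ENNReal.ofReal ((1 + ‖x‖) ^ (-a)) * ‖wave (Omega i j F) t x‖ₑ ^ 2 := by
    intro t x
    simp_rw [ofReal_angEnergy, wave_fderiv F hF, wave_omega F hF, mul_add, Finset.mul_sum]
    rfl
  simp_rw [hexp]
  have hmD : Measurable fun p : ℝ × Sp =>
      ∑ j, ENNReal.ofReal ((1 + ‖p.2‖) ^ (-a)) * ‖wave (D j) p.1 p.2‖ₑ ^ 2 :=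
    Finset.measurable_sum _ fun j _ => hm _ (hDm j)
  have hmO : ∀ i, Measurable fun p : ℝ × Sp =>
      ∑ j, ENNReal.ofReal ((1 + ‖p.2‖) ^ (-a)) * ‖wave (Omega i j F) p.1 p.2‖ₑ ^ 2 := fun i =>
    Finset.measurable_sum _ fun j _ => hm _ (hOm i j)
  have hmO' : Measurable fun p : ℝ × Sp => ∑ i,
      ∑ j, ENNReal.ofReal ((1 + ‖p.2‖) ^ (-a)) * ‖wave (Omega i j F) p.1 p.2‖ₑ ^ 2 :=
    Finset.measurable_sum _ fun i _ => hmO i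
  have hprod := lintegral_prod (μ := (volume : Measure ℝ)) (ν := (volume : Measure Sp))
    (fun p : ℝ × Sp =>
      ENNReal.ofReal ((1 + ‖p.2‖) ^ (-a)) * ‖wave F p.1 p.2‖ₑ ^ 2 +
      ∑ j, ENNReal.ofReal ((1 + ‖p.2‖) ^ (-a)) * ‖wave (D j) p.1 p.2‖ₑ ^ 2 +
      ∑ i, ∑ j, ENNReal.ofReal ((1 + ‖p.2‖) ^ (-a)) * ‖wave (Omega i j F) p.1 p.2‖ₑ ^ 2)
    (((hm F hFm).add hmD).add hmO').aemeasurable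
  rw [← hprod, lintegral_add_right _ hmO', lintegral_add_right _ hmD,
    lintegral_finsetSum _ (fun j _ => hm _ (hDm j)), lintegral_finsetSum _ (fun i _ => hmO i)]
  simp_rw [lintegral_finsetSum _ (fun j _ => hm _ (hOm _ j))]
  calc _ ≤ C * (∫⁻ ξ, ‖F ξ‖ₑ ^ 2) + ∑ _j : Fin 4, C * (K * ∫⁻ ξ, ‖F ξ‖ₑ ^ 2) +
        ∑ i, ∑ j, C * ∫⁻ ξ, ‖Omega i j F ξ‖ₑ ^ 2 := by
        refine add_le_add (add_le_add (h F hFm F.integrable hF)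
          (Finset.sum_le_sum fun j _ => ?_))
          (Finset.sum_le_sum fun i _ => Finset.sum_le_sum fun j _ => ?_)
        · refine (h _ (hDm j) (hDi j) fun ξ hξ => ?_).trans (mul_le_mul_right (hDsq j) _)
          simp [hD, hF ξ hξ]
        · exact h _ (hOm i j) (hOi i j) (Omega_eq_zero_of_notMem hF i j)
    _ = C * (1 + 4 * K) * (∫⁻ ξ, ‖F ξ‖ₑ ^ 2) + C * 1 * ∑ i, ∑ j, ∫⁻ ξ, ‖Omega i j F ξ‖ₑ ^ 2 := by
        simp_rw [Finset.mul_sum, mul_one]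
        simp only [Finset.sum_const, Finset.card_univ, Fintype.card_fin, nsmul_eq_mul]
        push_cast
        ring
    _ ≤ C * (1 + 4 * K) * (∫⁻ ξ, ‖F ξ‖ₑ ^ 2) +
        C * (1 + 4 * K) * ∑ i, ∑ j, ∫⁻ ξ, ‖Omega i j F ξ‖ₑ ^ 2 := by
        gcongr
        exact le_self_add
    _ = _ := by rw [angularNormSq, mul_add (C * (1 + 4 * K))]

lemma lintegral_wave_rpow_le {r : ℝ} (hr3 : 3 < r) (hr4 : r ≤ 4) : ∃ C : ℝ≥0∞, C ≠ ∞ ∧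
    ∀ F : 𝓢(Sp, ℂ), (∀ ξ, ξ ∉ unitAnnulus → F ξ = 0) →
    ∫⁻ t : ℝ, (∫⁻ x, ‖wave F t x‖ₑ ^ r) ^ (2 / r) ≤ C * angularNormSq F := by
  have ha : 1 < 3 - 6 / r := by
    have : 6 / r < 2 := by rw [div_lt_iff₀ (by linarith)]; linarith
    linarith
  obtain ⟨C₁, hC₁, h₁⟩ := lintegral_rpow_le_weight hr3 hr4
  obtain ⟨C₂, hC₂, h₂⟩ := lintegral_weight_angEnergy_wave_le ha
  refine ⟨C₁ * C₂, by finiteness, fun F hF => ?_⟩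
  calc _ ≤ ∫⁻ t : ℝ, C₁ * (∫⁻ x, ENNReal.ofReal ((1 + ‖x‖) ^ (-(3 - 6 / r))) *
        ENNReal.ofReal (angEnergy (wave F t) x)) :=
        lintegral_mono fun t => h₁ _ (contDiff_wave F hF t)
    _ ≤ _ := by
        rw [lintegral_const_mul' _ _ hC₁, mul_assoc]
        exact mul_le_mul_right (h₂ F hF) _

lemma angularNormSq_fourier (f : 𝓢(Sp, ℂ)) :
    angularNormSq (𝓕 f : 𝓢(Sp, ℂ)) = angularNormSq f := by
  conv_rhs => rw [← show 𝓕⁻ (𝓕 f : 𝓢(Sp, ℂ)) = f from FourierTransform.fourierInv_fourier_eq f]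
  rw [angularNormSq, angularNormSq, lintegral_fourierInv_sq]
  simp_rw [omega_fourierInv, lintegral_fourierInv_sq, omegaSchwartz_coe]

end

section

open scoped SchwartzMap

lemma exists_frequency_cutoff : ∃ χ : 𝓢(Sp, ℂ), HasCompactSupport χ ∧
    ∀ ξ ∈ unitAnnulus, χ ξ = 1 := by
  let b : ContDiffBump (0 : Sp) := ⟨2, 3, by norm_num, by norm_num⟩
  have hc : HasCompactSupport fun ξ : Sp => ((b ξ : ℝ) : ℂ) :=
    b.hasCompactSupport.comp_left (g := fun s : ℝ => (s : ℂ)) Complex.ofReal_zero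
  have hs : ContDiff ℝ ((⊤ : ℕ∞) : WithTop ℕ∞) fun ξ : Sp => ((b ξ : ℝ) : ℂ) :=
    Complex.ofRealCLM.contDiff.comp b.contDiff
  refine ⟨hc.toSchwartzMap hs, hc, fun ξ hξ => ?_⟩
  have : b ξ = 1 := b.one_of_mem_closedBall (by simpa using hξ.2)
  change ((b ξ : ℝ) : ℂ) = 1
  rw [this, Complex.ofReal_one]

lemma enorm_fourierInv_le_convolution {χ : 𝓢(Sp, ℂ)} (hχ : HasCompactSupport χ)
    (hχ1 : ∀ ξ ∈ unitAnnulus, χ ξ = 1) (P : 𝓢(Sp, ℂ)) (hP : ∀ ξ, ξ ∉ unitAnnulus → P ξ = 0)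
    (x : Sp) :
    ‖(𝓕⁻ P : 𝓢(Sp, ℂ)) x‖ₑ ≤
      ∫⁻ y, ‖(𝓕⁻ P : 𝓢(Sp, ℂ)) y‖ₑ * ‖(𝓕 χ : 𝓢(Sp, ℂ)) (y - x)‖ₑ := by
  have hs : ContDiff ℝ ((⊤ : ℕ∞) : WithTop ℕ∞) fun ξ : Sp =>
      cexp (2 * Real.pi * I * ((inner ℝ ξ x : ℝ) : ℂ)) * χ ξ := by
    have h1 : ContDiff ℝ ((⊤ : ℕ∞) : WithTop ℕ∞) fun ξ : Sp => ((inner ℝ ξ x : ℝ) : ℂ) :=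
      Complex.ofRealCLM.contDiff.comp (contDiff_id.inner ℝ contDiff_const)
    exact (contDiff_const.mul h1).cexp.mul (χ.smooth ⊤)
  have hc : HasCompactSupport fun ξ : Sp =>
      cexp (2 * Real.pi * I * ((inner ℝ ξ x : ℝ) : ℂ)) * χ ξ := hχ.mul_left
  set ψ : 𝓢(Sp, ℂ) := hc.toSchwartzMap hs with hψ
  have hψa : ∀ ξ, ψ ξ = cexp (2 * Real.pi * I * ((inner ℝ ξ x : ℝ) : ℂ)) * χ ξ := fun _ => rfl
  have hψF : ∀ y, (𝓕 ψ : 𝓢(Sp, ℂ)) y = (𝓕 χ : 𝓢(Sp, ℂ)) (y - x) := by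
    intro y
    rw [SchwartzMap.fourier_coe, SchwartzMap.fourier_coe, Real.fourier_eq', Real.fourier_eq']
    refine integral_congr_ae (Filter.Eventually.of_forall fun ξ => ?_)
    simp only [smul_eq_mul, hψa]
    rw [← mul_assoc, ← Complex.exp_add, inner_sub_right]
    congr 2
    push_cast
    ring
  have hrep : (𝓕⁻ P : 𝓢(Sp, ℂ)) x =
      ∫ y, (𝓕⁻ P : 𝓢(Sp, ℂ)) y * (𝓕 χ : 𝓢(Sp, ℂ)) (y - x) := by
    simp_rw [← hψF]
    rw [← SchwartzMap.integral_fourier_mul_eq, FourierTransform.fourier_fourierInv_eq,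
      SchwartzMap.fourierInv_coe, Real.fourierInv_eq']
    refine integral_congr_ae (Filter.Eventually.of_forall fun ξ => ?_)
    simp only [smul_eq_mul, hψa]
    by_cases hξ : ξ ∈ unitAnnulus
    · rw [hχ1 ξ hξ, mul_one, mul_comm]
      congr 2
      push_cast
      ring
    · simp [hP ξ hξ]
  rw [hrep]
  refine (enorm_integral_le_lintegral_enorm _).trans_eq ?_
  simp_rw [enorm_mul]

lemma lintegral_rpow_enorm_schwartz_ne_top (g : 𝓢(Sp, ℂ)) {p : ℝ} (hp : 1 ≤ p) :
    ∫⁻ x, ‖g x‖ₑ ^ p ≠ ∞ := by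
  have hp0 : 0 < p := by linarith
  have h := (g.memLp (ENNReal.ofReal p)).eLpNorm_ne_top
  rw [eLpNorm_eq_lintegral_rpow_enorm_toReal (by simpa using hp0) ENNReal.ofReal_ne_top,
    ENNReal.toReal_ofReal hp0.le] at h
  intro htop
  rw [htop, ENNReal.top_rpow_of_pos (by positivity)] at h
  exact h rfl

lemma enorm_fourierInv_le_lintegral_rpow {p : ℝ} (hp : 1 < p) : ∃ C : ℝ≥0∞, C ≠ ∞ ∧
    ∀ P : 𝓢(Sp, ℂ), (∀ ξ, ξ ∉ unitAnnulus → P ξ = 0) → ∀ x,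
      ‖(𝓕⁻ P : 𝓢(Sp, ℂ)) x‖ₑ ≤ C * (∫⁻ y, ‖(𝓕⁻ P : 𝓢(Sp, ℂ)) y‖ₑ ^ p) ^ (1 / p) := by
  obtain ⟨χ, hχ, hχ1⟩ := exists_frequency_cutoff
  have hpq := Real.HolderConjugate.conjExponent hp
  set s := p.conjExponent
  have hs : 1 < s := hpq.symm.lt
  have hs0 : 0 ≤ 1 / s := by positivity
  refine ⟨(∫⁻ y, ‖(𝓕 χ : 𝓢(Sp, ℂ)) y‖ₑ ^ s) ^ (1 / s),
    ENNReal.rpow_ne_top_of_nonneg hs0 (lintegral_rpow_enorm_schwartz_ne_top _ hs.le),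
    fun P hP x => (enorm_fourierInv_le_convolution hχ hχ1 P hP x).trans ?_⟩
  refine (ENNReal.lintegral_mul_le_Lp_mul_Lq volume hpq
    (SchwartzMap.continuous _).enorm.measurable.aemeasurable
    (((SchwartzMap.continuous (𝓕 χ : 𝓢(Sp, ℂ))).comp
      (continuous_id.sub continuous_const)).enorm.measurable.aemeasurable)).trans_eq ?_
  rw [mul_comm]
  congr 2
  exact lintegral_sub_right_eq_self (fun y => ‖(𝓕 χ : 𝓢(Sp, ℂ)) y‖ₑ ^ s) x

lemma lintegral_rpow_fourierInv_le {p r : ℝ} (hp : 1 < p) (hpr : p ≤ r) : ∃ C : ℝ≥0∞, C ≠ ∞ ∧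
    ∀ P : 𝓢(Sp, ℂ), (∀ ξ, ξ ∉ unitAnnulus → P ξ = 0) →
      (∫⁻ y, ‖(𝓕⁻ P : 𝓢(Sp, ℂ)) y‖ₑ ^ r) ^ (2 / r) ≤
        C * (∫⁻ y, ‖(𝓕⁻ P : 𝓢(Sp, ℂ)) y‖ₑ ^ p) ^ (2 / p) := by
  obtain ⟨C, hC, h⟩ := enorm_fourierInv_le_lintegral_rpow hp
  have hp0 : 0 < p := by linarith
  have hr0 : 0 < r := by linarith
  have hd : 0 ≤ r - p := by linarith
  refine ⟨C ^ ((r - p) * (2 / r)), ENNReal.rpow_ne_top_of_nonneg (by positivity) hC,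
    fun P hP => ?_⟩
  set A := ∫⁻ y, ‖(𝓕⁻ P : 𝓢(Sp, ℂ)) y‖ₑ ^ p with hA
  have h1 : ∫⁻ y, ‖(𝓕⁻ P : 𝓢(Sp, ℂ)) y‖ₑ ^ r ≤ (C * A ^ (1 / p)) ^ (r - p) * A := by
    rw [hA, ← lintegral_const_mul _
      ((SchwartzMap.continuous _).enorm.measurable.pow_const p)]
    refine lintegral_mono fun y => ?_
    calc _ = ‖(𝓕⁻ P : 𝓢(Sp, ℂ)) y‖ₑ ^ (r - p) * ‖(𝓕⁻ P : 𝓢(Sp, ℂ)) y‖ₑ ^ p := by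
          rw [← ENNReal.rpow_add_of_nonneg _ _ hd hp0.le, sub_add_cancel]
      _ ≤ _ := mul_le_mul_left (ENNReal.rpow_le_rpow (h P hP y) hd) _
  calc _ ≤ ((C * A ^ (1 / p)) ^ (r - p) * A) ^ (2 / r) :=
        ENNReal.rpow_le_rpow h1 (by positivity)
    _ = C ^ ((r - p) * (2 / r)) * (A ^ (1 / p * ((r - p) * (2 / r))) * A ^ (2 / r)) := by
        rw [ENNReal.mul_rpow_of_nonneg _ _ (by positivity), ← ENNReal.rpow_mul,
          ENNReal.mul_rpow_of_nonneg _ _ (by positivity), ← ENNReal.rpow_mul, mul_assoc]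
    _ = _ := by
        rw [← ENNReal.rpow_add_of_nonneg _ _ (by positivity) (by positivity)]
        congr 2
        field_simp
        ring

lemma lintegral_wave_rpow_le_of_three_lt {r : ℝ} (hr : 3 < r) : ∃ C : ℝ≥0∞, C ≠ ∞ ∧
    ∀ F : 𝓢(Sp, ℂ), (∀ ξ, ξ ∉ unitAnnulus → F ξ = 0) →
    ∫⁻ t : ℝ, (∫⁻ x, ‖wave F t x‖ₑ ^ r) ^ (2 / r) ≤ C * angularNormSq F := by
  have hm : 3 < min r 4 := lt_min hr (by norm_num)
  obtain ⟨C₁, hC₁, h₁⟩ := lintegral_rpow_fourierInv_le (p := min r 4) (r := r) (by linarith)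
    (min_le_left _ _)
  obtain ⟨C₂, hC₂, h₂⟩ := lintegral_wave_rpow_le hm (min_le_right _ _)
  refine ⟨C₁ * C₂, by finiteness, fun F hF => ?_⟩
  calc _ ≤ ∫⁻ t : ℝ, C₁ * (∫⁻ x, ‖wave F t x‖ₑ ^ (min r 4)) ^ (2 / (min r 4)) := by
        refine lintegral_mono fun t => ?_
        simp only [wave_eq_phaseSchwartz F hF]
        refine h₁ _ fun ξ hξ => ?_
        rw [phaseSchwartz_apply, hF ξ hξ, mul_zero]
    _ ≤ _ := by
        rw [lintegral_const_mul' _ _ hC₁, mul_assoc]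
        exact mul_le_mul_right (h₂ F hF) _

end

lemma lintegral_enorm_sq_eq_eLpNorm_sq (g : Sp → ℂ) :
    ∫⁻ x, ‖g x‖ₑ ^ 2 = eLpNorm g 2 volume ^ 2 := by
  rw [eLpNorm_eq_lintegral_rpow_enorm_toReal (by norm_num) (by norm_num), ← ENNReal.rpow_natCast,
    ← ENNReal.rpow_mul]
  simp

lemma eLpNorm_Omega_swap (g : Sp → ℂ) (i j : Fin 4) :
    eLpNorm (Omega i j g) 2 volume = eLpNorm (Omega j i g) 2 volume := by
  rw [← eLpNorm_neg]
  congr 1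
  funext x
  simp [Omega]

lemma angularNormSq_le (g : Sp → ℂ) : angularNormSq g ≤ 17 *
    (eLpNorm g 2 volume + ∑ i : Fin 4, ∑ j : Fin 4,
      if i < j then eLpNorm (Omega i j g) 2 volume else 0) ^ 2 := by
  set T := ∑ i : Fin 4, ∑ j : Fin 4, if i < j then eLpNorm (Omega i j g) 2 volume else 0 with hT
  have hlt : ∀ i j : Fin 4, i < j → eLpNorm (Omega i j g) 2 volume ≤ T := by
    intro i j hij
    calc _ = if i < j then eLpNorm (Omega i j g) 2 volume else 0 := by rw [if_pos hij]
      _ ≤ ∑ j : Fin 4, if i < j then eLpNorm (Omega i j g) 2 volume else 0 :=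
        Finset.single_le_sum (f := fun j => if i < j then eLpNorm (Omega i j g) 2 volume else 0)
          (fun _ _ => zero_le) (Finset.mem_univ j)
      _ ≤ T := Finset.single_le_sum (f := fun i => ∑ j : Fin 4,
          if i < j then eLpNorm (Omega i j g) 2 volume else 0)
          (fun _ _ => zero_le) (Finset.mem_univ i)
  have hall : ∀ i j : Fin 4, eLpNorm (Omega i j g) 2 volume ≤ T := by
    intro i j
    rcases lt_trichotomy i j with h | h | h
    · exact hlt i j h
    · subst h
      have : Omega i i g = 0 := by funext x; simp [Omega]
      simp [this]
    · rw [eLpNorm_Omega_swap]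
      exact hlt j i h
  rw [angularNormSq]
  simp_rw [lintegral_enorm_sq_eq_eLpNorm_sq]
  set N := eLpNorm g 2 volume
  calc _ ≤ (N + T) ^ 2 + ∑ _i : Fin 4, ∑ _j : Fin 4, (N + T) ^ 2 := by
        refine add_le_add (pow_le_pow_left' le_self_add 2)
          (Finset.sum_le_sum fun i _ => Finset.sum_le_sum fun j _ => ?_)
        exact pow_le_pow_left' ((hall i j).trans le_add_self) 2
    _ = _ := by
        simp only [Finset.sum_const, Finset.card_univ, Fintype.card_fin, nsmul_eq_mul]
        push_cast
        ring

lemma LqLr_wave_le {q r : ℝ} (hq : 2 ≤ q) (hr : 2 ≤ r) (h₁ : 3 / 4 ≤ 1 / q + 3 / (2 * r))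
    (h₂ : 1 / q + 3 / r < 3 / 2) : ∃ C : ℝ≥0∞, C ≠ ∞ ∧
    ∀ F : SchwartzMap Sp ℂ, (∀ ξ, ξ ∉ unitAnnulus → F ξ = 0) →
      LqLr (ENNReal.ofReal q) (ENNReal.ofReal r) (wave F) ≤
        C * angularNormSq F ^ (1 / 2 : ℝ) := by
  have hq0 : 0 < q := by linarith
  have hr0 : 0 < r := by linarith
  have ha : 0 < 1 / q := by positivity
  have hb : 0 < 1 / r := by positivity
  have hb2 : 1 / r ≤ 1 / 2 := one_div_le_one_div_of_le (by norm_num) hr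
  have e1 : 3 / (2 * r) = 3 / 2 * (1 / r) := by field_simp
  have e2 : 3 / r = 3 * (1 / r) := by ring
  rw [e1] at h₁
  rw [e2] at h₂
  have hd : 0 < 1 / r - 1 / 2 + 1 / q := by linarith
  set d := 1 / r - 1 / 2 + 1 / q with hdd
  set r₀ := 2 / (q * d) with hr₀
  have hr₀3 : 3 < r₀ := by
    rw [hr₀, lt_div_iff₀ (by positivity)]
    have : q * d = q * (1 / r - 1 / 2) + 1 := by rw [hdd]; field_simp
    have h3 : q * (1 / q + 3 * (1 / r)) < q * (3 / 2) := mul_lt_mul_of_pos_left h₂ hq0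
    rw [mul_add, mul_one_div_cancel hq0.ne'] at h3
    linarith
  have hr₀0 : 0 < r₀ := by linarith
  have hθ0 : 0 ≤ r * d := by positivity
  have hrd : r * d = 1 - r * (1 / 2 - 1 / q) := by rw [hdd]; field_simp; ring
  have hqh : 1 / q ≤ 1 / 2 := one_div_le_one_div_of_le (by norm_num) hq
  have hθ1 : r * d ≤ 1 := by
    rw [hrd]
    have : 0 ≤ r * (1 / 2 - 1 / q) := mul_nonneg hr0.le (by linarith)
    linarith
  have hpr : r = r₀ * (r * d) + 2 * (1 - r * d) := by
    have : r₀ * (r * d) = 2 * r * (1 / q) := by rw [hr₀]; field_simp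
    rw [this, hrd]
    ring
  have hqr : 0 ≤ q / r := by positivity
  have hexp : (1 - r * d) * (q / r) = q / 2 - 1 := by rw [hrd]; field_simp; ring
  have hq2 : 0 ≤ q / 2 - 1 := by linarith
  obtain ⟨C, hC, h⟩ := lintegral_wave_rpow_le_of_three_lt hr₀3
  refine ⟨C ^ (1 / q), ENNReal.rpow_ne_top_of_nonneg ha.le hC, fun F hF => ?_⟩
  have hpt : ∀ t : ℝ, ‖(eLpNorm (wave F t) (ENNReal.ofReal r) volume).toReal‖ₑ ^ q ≤
      (∫⁻ x, ‖wave F t x‖ₑ ^ r₀) ^ (2 / r₀) * angularNormSq F ^ (q / 2 - 1) := by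
    intro t
    have hle : ‖(eLpNorm (wave F t) (ENNReal.ofReal r) volume).toReal‖ₑ ≤
        eLpNorm (wave F t) (ENNReal.ofReal r) volume := by
      rw [Real.enorm_eq_ofReal ENNReal.toReal_nonneg]
      exact ENNReal.ofReal_toReal_le
    have h_int := lintegral_rpow_le_interp (μ := volume) (g := fun x => ‖wave F t x‖ₑ)
      (contDiff_wave F hF t).continuous.enorm.measurable.aemeasurable hr₀0.le zero_le_two hθ0 hθ1
      hpr
    simp only [ENNReal.rpow_two] at h_int
    rw [lintegral_wave_sq F hF] at h_int
    calc _ ≤ eLpNorm (wave F t) (ENNReal.ofReal r) volume ^ q := ENNReal.rpow_le_rpow hle hq0.le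
      _ = (∫⁻ x, ‖wave F t x‖ₑ ^ r) ^ (q / r) := by
          rw [eLpNorm_eq_lintegral_rpow_enorm_toReal (by simpa using hr0) ENNReal.ofReal_ne_top,
            ENNReal.toReal_ofReal hr0.le, ← ENNReal.rpow_mul, one_div_mul_eq_div]
      _ ≤ ((∫⁻ x, ‖wave F t x‖ₑ ^ r₀) ^ (r * d) * (∫⁻ ξ, ‖F ξ‖ₑ ^ 2) ^ (1 - r * d)) ^ (q / r) :=
          ENNReal.rpow_le_rpow h_int hqr
      _ = (∫⁻ x, ‖wave F t x‖ₑ ^ r₀) ^ (2 / r₀) * (∫⁻ ξ, ‖F ξ‖ₑ ^ 2) ^ (q / 2 - 1) := by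
          rw [ENNReal.mul_rpow_of_nonneg _ _ hqr, ← ENNReal.rpow_mul, ← ENNReal.rpow_mul, hexp]
          congr 2
          rw [hr₀]
          field_simp
      _ ≤ _ := mul_le_mul_right (ENNReal.rpow_le_rpow le_self_add hq2) _
  rw [LqLr, eLpNorm_eq_lintegral_rpow_enorm_toReal (by simpa using hq0) ENNReal.ofReal_ne_top,
    ENNReal.toReal_ofReal hq0.le]
  have hm : Measurable fun t : ℝ => (∫⁻ x, ‖wave F t x‖ₑ ^ r₀) ^ (2 / r₀) :=
    (((measurable_wave F.continuous.measurable).enorm.pow_const r₀).lintegral_prod_right').pow_const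
      _
  calc _ ≤ (C * angularNormSq F * angularNormSq F ^ (q / 2 - 1)) ^ (1 / q) := by
        refine ENNReal.rpow_le_rpow ((lintegral_mono hpt).trans ?_) ha.le
        rw [lintegral_mul_const _ hm]
        exact mul_le_mul_left (h F hF) _
    _ = (C * angularNormSq F ^ (q / 2)) ^ (1 / q) := by
        rw [mul_assoc]
        nth_rewrite 1 [← ENNReal.rpow_one (angularNormSq F)]
        rw [← ENNReal.rpow_add_of_nonneg _ _ zero_le_one hq2]
        congr 3
        ring
    _ = _ := by
        rw [ENNReal.mul_rpow_of_nonneg _ _ ha.le, ← ENNReal.rpow_mul]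
        congr 2
        field_simp

/-- (Strichartz estimates for angularly regular data on `ℝ^{4+1}`.)
For every unit-frequency Schwartz function `f : ℝ⁴ → ℂ`, `u(t,x) = e^{it√(−Δ)}f(x)`, and
all exponents `q, r ∈ [2,∞)` satisfying `1/q + 3/(2r) ≥ 3/4` and `1/q + 3/r < 3/2`, one has
`‖u‖_{L^q_t L^r_x} ≤ C_{q,r} (‖f‖_{L²} + Σ_{i<j} ‖Ω_{ij}f‖_{L²})`
with a constant independent of `f`. -/
theorem statement7 (q r : ℝ) (hq : 2 ≤ q) (hr : 2 ≤ r)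
    (hadm1 : 3/4 ≤ 1/q + 3/(2*r)) (hadm2 : 1/q + 3/r < 3/2) :
    ∃ C : ℝ, 0 < C ∧ ∀ f : SchwartzMap Sp ℂ, UnitFrequency f →
      LqLr (ENNReal.ofReal q) (ENNReal.ofReal r) (halfWave f) ≤
        ENNReal.ofReal C *
          (eLpNorm (⇑f) 2 volume +
            ∑ i : Fin 4, ∑ j : Fin 4,
              if i < j then eLpNorm (Omega i j f) 2 volume else 0) := by
  obtain ⟨C, hC, h⟩ := LqLr_wave_le hq hr hadm1 hadm2
  have hfin : C * 17 ^ (1 / 2 : ℝ) ≠ ∞ :=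
    ENNReal.mul_ne_top hC (ENNReal.rpow_ne_top_of_nonneg (by norm_num) (by norm_num))
  refine ⟨(C * 17 ^ (1 / 2 : ℝ)).toReal + 1, by positivity, fun f hf => ?_⟩
  set S := eLpNorm (⇑f) 2 volume + ∑ i : Fin 4, ∑ j : Fin 4,
    if i < j then eLpNorm (Omega i j f) 2 volume else 0 with hS
  have hF : ∀ ξ, ξ ∉ unitAnnulus → (𝓕 f : SchwartzMap Sp ℂ) ξ = 0 := by
    intro ξ hξ
    by_contra hne
    rw [SchwartzMap.fourier_coe] at hne
    exact hξ (hf ξ hne)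
  have hw : halfWave f = wave (𝓕 f : SchwartzMap Sp ℂ) := by
    rw [SchwartzMap.fourier_coe]
    rfl
  rw [hw]
  calc _ ≤ C * angularNormSq f ^ (1 / 2 : ℝ) := by
        rw [← angularNormSq_fourier]
        exact h _ hF
    _ ≤ C * (17 * S ^ 2) ^ (1 / 2 : ℝ) :=
        mul_le_mul_right (ENNReal.rpow_le_rpow (angularNormSq_le f) (by norm_num)) _
    _ = C * 17 ^ (1 / 2 : ℝ) * S := by
        rw [ENNReal.mul_rpow_of_nonneg _ _ (by norm_num), ← ENNReal.rpow_two, ← ENNReal.rpow_mul,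
          mul_assoc]
        norm_num
    _ ≤ _ := by
        refine mul_le_mul_left ?_ _
        rw [← ENNReal.ofReal_toReal hfin]
        exact ENNReal.ofReal_le_ofReal (by rw [ENNReal.ofReal_toReal hfin]; linarith)

end
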